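/- Assume BH(s,r) holds for some 3/2 < s < 2 and r < s', and let Ω, K, J, ε, C and the sets S_η, Ω¹_η = Ω ∩ π₁^{-1}(S_η) be as in the first-stage decomposition. Fix dyadic 0 < η ≤ ε and define, for dyadic 0 < ρ ≤ η: V_ρ = {ξ₂ ∈ π₂(Ω¹_η) : 𝓗¹({ξ₁ : (ξ₁,ξ₂) ∈ Ω¹_η}) ≥ ρ^C 2^{-J}}, U_η = V_η, U_ρ = V_ρ \ V_{2ρ} for ρ < η, and Ω²_{η,ρ} = π₂^{-1}(U_ρ) ∩ Ω¹_η. Then for each dyadic 0 < ρ < η ≤ ε and each measurable Ω' ⊆ Ω²_{η,ρ}, ∥𝓔χ_{Ω'}∥_{L^{2s}(ℝ³)} ≲ ρ² |Ω|^{1/s'}. -/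

import Mathlib

open MeasureTheory Set
open scoped ENNReal

/-- The extension operator for the hyperbolic paraboloid `τ = ξ₁ξ₂` in `ℝ³`:
`𝓔f(t,x) = ∫_{ℝ²} e^{i(tξ₁ξ₂ + x·ξ)} f(ξ) dξ`. -/
noncomputable def extOp (f : ℝ × ℝ → ℂ) (p : ℝ × ℝ × ℝ) : ℂ :=
  ∫ ξ : ℝ × ℝ,
    Complex.exp (Complex.I * (p.1 * ξ.1 * ξ.2 + p.2.1 * ξ.1 + p.2.2 * ξ.2 : ℝ)) * f ξ

/-- Characteristic function of a set, valued in `ℂ`. -/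
noncomputable def chi (Ω : Set (ℝ × ℝ)) : ℝ × ℝ → ℂ := Ω.indicator fun _ => 1

/-- The axis-parallel unit square with lower-left corner `(a, b)`. -/
def unitSq (a b : ℝ) : Set (ℝ × ℝ) := Icc a (a + 1) ×ˢ Icc b (b + 1)

/-- Bilinear hypothesis BH(s,r) with constant `A`: a bilinear adjoint restriction estimate
`∥𝓔f·𝓔g∥_{L^s} ≤ A ∥f∥_{L^r} ∥g∥_{L^r}` whenever `f, g` are supported in `1 × 1`
axis-parallel squares whose projections onto each coordinate axis are separated by a
distance between `1` and `4` (equivalently, the corners satisfy `2 ≤ |aᵢ - bᵢ| ≤ 5`). -/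
def BH (s r A : ℝ) : Prop :=
  ∀ a₁ a₂ b₁ b₂ : ℝ, 2 ≤ |a₁ - b₁| → |a₁ - b₁| ≤ 5 → 2 ≤ |a₂ - b₂| → |a₂ - b₂| ≤ 5 →
    ∀ f g : ℝ × ℝ → ℂ,
      Function.support f ⊆ unitSq a₁ a₂ → Function.support g ⊆ unitSq b₁ b₂ →
      eLpNorm (fun p => extOp f p * extOp g p) (ENNReal.ofReal s) volume ≤
        ENNReal.ofReal A * eLpNorm f (ENNReal.ofReal r) volume *
          eLpNorm g (ENNReal.ofReal r) volume


/-- The dyadic interval `[m·2⁻ⁿ, (m+1)·2⁻ⁿ]`. -/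
def dyadicIcc (n m : ℤ) : Set ℝ := Icc ((m : ℝ) * 2 ^ (-n)) (((m : ℝ) + 1) * 2 ^ (-n))

/-- A tile in `𝓓_{j,k}`: a product of a dyadic interval of length `2⁻ʲ` with one of
length `2⁻ᵏ`. -/
def tile (j k m m' : ℤ) : Set (ℝ × ℝ) := dyadicIcc j m ×ˢ dyadicIcc k m'

/-- A dyadic number is one of the form `2ⁿ`, `n ∈ ℤ`. -/
def IsDyadic (x : ℝ) : Prop := ∃ n : ℤ, x = 2 ^ n

/-- The vertical fiber of `Ω ⊆ ℝ²` over `x`: `{η : (x, η) ∈ Ω}`. -/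
def vFiber (Ω : Set (ℝ × ℝ)) (x : ℝ) : Set ℝ := {y | (x, y) ∈ Ω}

/-- `Ω(K) = {ξ ∈ Ω : 2^{-K-1} ≤ 𝓗¹({η : (ξ₁,η) ∈ Ω}) ≤ 2^{-K+1}}`, the piece of `Ω` whose
vertical fibers have length about `2⁻ᴷ`. -/
noncomputable def fiberPiece (Ω : Set (ℝ × ℝ)) (K : ℕ) : Set (ℝ × ℝ) :=
  {ξ ∈ Ω | (2 : ℝ≥0∞) ^ (-(K : ℤ) - 1) ≤ volume (vFiber Ω ξ.1) ∧
    volume (vFiber Ω ξ.1) ≤ (2 : ℝ≥0∞) ^ (-(K : ℤ) + 1)}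

/-- `VargasBound s Ω c` says `∥𝓔χ_{Ω'}∥_{L^{2s}} ≤ c·|Ω|^{1/s'}` for every measurable
`Ω' ⊆ Ω` (here `1/s' = 1 - 1/s`). -/
def VargasBound (s : ℝ) (Ω : Set (ℝ × ℝ)) (c : ℝ) : Prop :=
  ∀ Ω' ⊆ Ω, MeasurableSet Ω' →
    eLpNorm (extOp (chi Ω')) (ENNReal.ofReal (2 * s)) volume ≤
      ENNReal.ofReal c * volume Ω ^ (1 - 1 / s)

/-- `Tset S C J η` is the set `T_η`: points `ξ₁ ∈ S` for which there is a dyadic interval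
`I ∋ ξ₁` with `|I| ≥ η^C 2^{-J}` and `|I ∩ S| ≥ η^C |I|`; equivalently, the maximal dyadic
interval `I_η(ξ₁) ∋ ξ₁` with `|I_η(ξ₁) ∩ S| ≥ η^C |I_η(ξ₁)|` satisfies
`|I_η(ξ₁)| ≥ η^C 2^{-J}`. -/
noncomputable def Tset (S : Set ℝ) (C : ℝ) (J : ℕ) (η : ℝ) : Set ℝ :=
  {x ∈ S | ∃ n m : ℤ, x ∈ dyadicIcc n m ∧ η ^ C * (2 : ℝ) ^ (-(J : ℤ)) ≤ (2 : ℝ) ^ (-n) ∧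
    ENNReal.ofReal (η ^ C * (2 : ℝ) ^ (-n)) ≤ volume (dyadicIcc n m ∩ S)}

/-- `Sset S C J ε η` is the set `S_η`: `S_η = T_η \ T_{2η}` for `η < ε`, and `S_ε = T_ε`. -/
noncomputable def Sset (S : Set ℝ) (C : ℝ) (J : ℕ) (ε η : ℝ) : Set ℝ :=
  if η < ε then Tset S C J η \ Tset S C J (2 * η) else Tset S C J η

/-- The horizontal fiber of a set `Ω₁ ⊆ ℝ²` at height `ξ₂`: `{ξ₁ : (ξ₁, ξ₂) ∈ Ω₁}`. -/
def hFiber (Ω₁ : Set (ℝ × ℝ)) (y : ℝ) : Set ℝ := {x | (x, y) ∈ Ω₁}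

/-- `Vset Ω₁ C J ρ` is `V_ρ = {ξ₂ ∈ π₂(Ω₁) : 𝓗¹({ξ₁ : (ξ₁,ξ₂) ∈ Ω₁}) ≥ ρ^C 2^{-J}}`. -/
noncomputable def Vset (Ω₁ : Set (ℝ × ℝ)) (C : ℝ) (J : ℕ) (ρ : ℝ) : Set ℝ :=
  {y ∈ Prod.snd '' Ω₁ |
    ENNReal.ofReal (ρ ^ C * (2 : ℝ) ^ (-(J : ℤ))) ≤ volume (hFiber Ω₁ y)}

/-- `Uset Ω₁ C J η ρ` is `U_ρ`: `U_ρ = V_ρ \ V_{2ρ}` for `ρ < η`, and `U_η = V_η`. -/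
noncomputable def Uset (Ω₁ : Set (ℝ × ℝ)) (C : ℝ) (J : ℕ) (η ρ : ℝ) : Set ℝ :=
  if ρ < η then Vset Ω₁ C J ρ \ Vset Ω₁ C J (2 * ρ) else Vset Ω₁ C J ρ



open scoped FourierTransform SchwartzMap in
/-- A reproducing kernel for functions with frequency in `[-1,1]`. -/
theorem exists_kernel : ∃ (φ : ℝ → ℂ) (c : ℝ), Continuous φ ∧ 0 < c ∧
    (∀ u, ‖φ u‖ ≤ c / (1 + u ^ 2)) ∧
    ∀ θ : ℝ, |θ| ≤ 1 → ∫ u : ℝ, φ u * Complex.exp (-Complex.I * (u * θ : ℝ)) = 1 := by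
  let b : ContDiffBump (0 : ℝ) := ⟨1, 2, by norm_num, by norm_num⟩
  have hb1 : HasCompactSupport (fun x => (b x : ℂ)) := by
    have := b.hasCompactSupport
    exact this.comp_left (g := fun x : ℝ => (x : ℂ)) (by simp)
  have hb2 : ContDiff ℝ ((⊤ : ℕ∞) : WithTop ℕ∞) (fun x => (b x : ℂ)) :=
    Complex.ofRealCLM.contDiff.comp b.contDiff
  let B : 𝓢(ℝ, ℂ) := hb1.toSchwartzMap hb2
  let ψ : 𝓢(ℝ, ℂ) := 𝓕⁻ B
  have hψ : 𝓕 ψ = B := FourierTransform.fourier_fourierInv_eq B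
  obtain ⟨c0, hc0⟩ := ψ.decay 0 0
  obtain ⟨c2, hc2⟩ := ψ.decay 2 0
  refine ⟨fun u => ((2 * Real.pi)⁻¹ : ℝ) * ψ ((2 * Real.pi)⁻¹ * u), 
    (c0 + c2 * (2 * Real.pi)^2), ?_, ?_, ?_, ?_⟩
  · have := ψ.continuous
    fun_prop
  · have := hc0.1
    have := hc2.1
    positivity
  · intro u
    have h0 := hc0.2 ((2 * Real.pi)⁻¹ * u)
    have h2 := hc2.2 ((2 * Real.pi)⁻¹ * u)
    simp only [pow_zero, norm_iteratedFDeriv_zero, one_mul] at h0 h2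
    rw [Real.norm_eq_abs, sq_abs] at h2
    rw [le_div_iff₀ (by positivity), norm_mul, Complex.norm_real]
    have hpi : (1:ℝ) ≤ 2 * Real.pi := by linarith [Real.pi_gt_three]
    have hn : ‖(2 * Real.pi)⁻¹‖ ≤ 1 := by
      rw [Real.norm_of_nonneg (by positivity)]
      exact inv_le_one_of_one_le₀ hpi
    have hu : ‖ψ ((2 * Real.pi)⁻¹ * u)‖ * u ^ 2 ≤ c2 * (2 * Real.pi) ^ 2 := by
      have : ‖ψ ((2 * Real.pi)⁻¹ * u)‖ * u ^ 2 = 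
        (((2 * Real.pi)⁻¹ * u) ^ 2 * ‖ψ ((2 * Real.pi)⁻¹ * u)‖) * (2 * Real.pi) ^ 2 := by
        field_simp
      rw [this]
      gcongr
    calc _ ≤ 1 * ‖ψ ((2 * Real.pi)⁻¹ * u)‖ * (1 + u ^ 2) := by gcongr
      _ = ‖ψ ((2 * Real.pi)⁻¹ * u)‖ + ‖ψ ((2 * Real.pi)⁻¹ * u)‖ * u ^ 2 := by ring
      _ ≤ _ := by gcongr
  · intro θ hθ
    have h1 : (𝓕 ψ) θ = 1 := by
      rw [hψ]
      change ((b θ : ℝ) : ℂ) = 1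
      rw [b.one_of_mem_closedBall (by simpa using hθ)]; simp
    have h1' : 𝓕 (ψ : ℝ → ℂ) θ = 1 := by
      rw [← SchwartzMap.fourier_coe]; exact h1
    rw [Real.fourier_real_eq_integral_exp_smul] at h1'
    rw [← h1']
    have hpi : (2 * Real.pi)⁻¹ ≠ 0 := by positivity
    have := MeasureTheory.Measure.integral_comp_mul_left 
      (fun v : ℝ => Complex.exp (((-2 * Real.pi * v * θ : ℝ) : ℂ) * Complex.I) • ψ v) (2 * Real.pi)⁻¹
    rw [inv_inv, abs_of_pos (by positivity)] at this
    have h3 : ∀ u : ℝ, ((2 * Real.pi)⁻¹ : ℝ) * ψ ((2 * Real.pi)⁻¹ * u) * Complex.exp (-Complex.I * (u * θ : ℝ))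
      = (((2 * Real.pi)⁻¹ : ℝ) : ℂ) * (Complex.exp (((-2 * Real.pi * ((2 * Real.pi)⁻¹ * u) * θ : ℝ) : ℂ) * Complex.I) • ψ ((2 * Real.pi)⁻¹ * u)) := by
      intro u
      have : -2 * Real.pi * ((2 * Real.pi)⁻¹ * u) * θ = - (u * θ) := by field_simp
      rw [this, smul_eq_mul]
      push_cast
      ring_nf
    simp_rw [h3]
    rw [integral_const_mul, this]
    rw [Complex.real_smul, ← mul_assoc, ← Complex.ofReal_mul, inv_mul_cancel₀ (by positivity)]
    simp

/-- Orthogonality of exponentials on an interval of length `π`. -/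
theorem trig_interval (M : Finset ℤ) (a : ℤ → ℂ) (l : ℤ) :
    ∫⁻ u in Ioc (l * Real.pi) ((l + 1) * Real.pi),
      ‖∑ m ∈ M, a m * Complex.exp (Complex.I * (2 * m * u : ℝ))‖ₑ ^ (2:ℕ) =
      ENNReal.ofReal Real.pi * ∑ m ∈ M, ‖a m‖ₑ ^ (2:ℕ) := by
  have hle : (l * Real.pi : ℝ) ≤ (l + 1) * Real.pi := by nlinarith [Real.pi_pos]
  have key : ∫ u in (l * Real.pi : ℝ)..((l + 1) * Real.pi), 
      ‖∑ m ∈ M, a m * Complex.exp (Complex.I * (2 * m * u : ℝ))‖ ^ 2 =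
      Real.pi * ∑ m ∈ M, ‖a m‖ ^ 2 := by
    have hC : ((∫ u in (l * Real.pi : ℝ)..((l + 1) * Real.pi), 
      ‖∑ m ∈ M, a m * Complex.exp (Complex.I * (2 * m * u : ℝ))‖ ^ 2 : ℝ) : ℂ) =
      ((Real.pi * ∑ m ∈ M, ‖a m‖ ^ 2 : ℝ) : ℂ) := by
      rw [← intervalIntegral.integral_ofReal]
      have e1 : ∀ u : ℝ, ((‖∑ m ∈ M, a m * Complex.exp (Complex.I * (2 * m * u : ℝ))‖ ^ 2 : ℝ) : ℂ)
        = ∑ m ∈ M, ∑ n ∈ M, a m * (starRingEnd ℂ) (a n) * Complex.exp ((2 * Complex.I * (m - n : ℤ)) * u) := by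
        intro u
        rw [Complex.ofReal_pow, ← Complex.mul_conj', map_sum, Finset.sum_mul_sum]
        refine Finset.sum_congr rfl fun m _ => Finset.sum_congr rfl fun n _ => ?_
        rw [map_mul, ← Complex.exp_conj, map_mul, Complex.conj_I, Complex.conj_ofReal]
        rw [mul_mul_mul_comm, ← Complex.exp_add]
        congr 2
        push_cast; ring
      simp_rw [e1]
      rw [intervalIntegral.integral_finsetSum]
      · have e2 : ∀ m ∈ M, ∫ u in (l * Real.pi : ℝ)..((l + 1) * Real.pi), ∑ n ∈ M, a m * (starRingEnd ℂ) (a n) * Complex.exp ((2 * Complex.I * (m - n : ℤ)) * u) = Real.pi * (‖a m‖ ^ 2 : ℝ) := by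
          intro m hm
          rw [intervalIntegral.integral_finsetSum]
          · rw [Finset.sum_eq_single m]
            · simp [Complex.mul_conj']
              left; ring
            · intro n hn hnm
              rw [intervalIntegral.integral_const_mul, integral_exp_mul_complex]
              · have : Complex.exp (2 * Complex.I * ((m - n : ℤ):ℂ) * (((l+1) * Real.pi : ℝ) : ℂ)) = Complex.exp (2 * Complex.I * ((m - n : ℤ):ℂ) * ((l * Real.pi : ℝ) : ℂ)) := by
                  rw [Complex.exp_eq_exp_iff_exists_int]
                  exact ⟨m - n, by push_cast; ring⟩
                rw [this]; simp
              · have : ((m - n : ℤ):ℂ) ≠ 0 := by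
                  exact_mod_cast sub_ne_zero.mpr (Ne.symm hnm)
                exact mul_ne_zero (by simp) this
            · intro h; exact absurd hm h
          · intro n _
            apply Continuous.intervalIntegrable
            fun_prop
        rw [Finset.sum_congr rfl e2]
        push_cast
        rw [Finset.mul_sum]
      · intro m _
        apply Continuous.intervalIntegrable
        fun_prop
    exact_mod_cast hC
  rw [intervalIntegral.integral_of_le hle] at key
  have := ofReal_integral_eq_lintegral_ofReal (μ := volume.restrict (Ioc (l * Real.pi) ((l + 1) * Real.pi)))
    (f := fun u : ℝ => ‖∑ m ∈ M, a m * Complex.exp (Complex.I * (2 * m * u : ℝ))‖ ^ 2) ?_ ?_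
  · rw [key] at this
    have e3 : ∀ x : ℂ, ‖x‖ₑ ^ (2:ℕ) = ENNReal.ofReal (‖x‖ ^ 2) := by
      intro x; rw [ENNReal.ofReal_pow (norm_nonneg _), ofReal_norm]
    simp_rw [e3]
    rw [← this, ENNReal.ofReal_mul Real.pi_pos.le, ENNReal.ofReal_sum_of_nonneg (fun _ _ => by positivity)]
  · apply Continuous.integrableOn_Ioc
    fun_prop
  · exact Filter.Eventually.of_forall fun _ => by positivity


theorem summable_wt : Summable (fun l : ℤ => 1 / (1 + (l:ℝ) ^ 2)) := by
  have h1 : Summable (fun l : ℤ => 1 / (l:ℝ) ^ 2) := Real.summable_one_div_int_pow.mpr (by norm_num)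
  have h2 : Summable (fun l : ℤ => if l = 0 then (1:ℝ) else 0) := (hasSum_ite_eq 0 1).summable
  refine Summable.of_nonneg_of_le (fun l => by positivity) (fun l => ?_) (h1.add h2)
  by_cases h : l = 0
  · simp [h]
  · have : (0:ℝ) < (l:ℝ)^2 := by positivity
    simp only [h, if_false, add_zero]
    gcongr
    linarith

/-- Weighted `L²` bound for trigonometric polynomials. -/
theorem trig_weighted (c : ℝ) (hc : 0 < c) : ∃ C1 : ℝ≥0∞, C1 ≠ ∞ ∧ ∀ (φ : ℝ → ℂ),
    (∀ u, ‖φ u‖ ≤ c / (1 + u ^ 2)) → ∀ (M : Finset ℤ) (a : ℤ → ℂ),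
    ∫⁻ u, ‖φ u‖ₑ * ‖∑ m ∈ M, a m * Complex.exp (Complex.I * (2 * m * u : ℝ))‖ₑ ^ (2:ℕ) ≤
      C1 * ∑ m ∈ M, ‖a m‖ₑ ^ (2:ℕ) := by
  let ω : ℤ → ℝ := fun l => c * (1 / (1 + (l:ℝ) ^ 2)) + c * (1 / (1 + ((l + 1 : ℤ):ℝ) ^ 2))
  have hω : Summable ω := (summable_wt.mul_left c).add
    (((Equiv.addRight (1:ℤ)).summable_iff.mpr summable_wt).mul_left c)
  refine ⟨(∑' l, ENNReal.ofReal (ω l)) * ENNReal.ofReal Real.pi,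
    ENNReal.mul_ne_top hω.tsum_ofReal_ne_top ENNReal.ofReal_ne_top, ?_⟩
  intro φ hφ M a
  have hU : (⋃ l : ℤ, Ioc ((l:ℝ) * Real.pi) ((l + 1) * Real.pi)) = univ := by
    have := iUnion_Ioc_zsmul (Real.pi_pos)
    simpa using this
  calc ∫⁻ u, ‖φ u‖ₑ * ‖∑ m ∈ M, a m * Complex.exp (Complex.I * (2 * m * u : ℝ))‖ₑ ^ (2:ℕ)
      = ∫⁻ u in (⋃ l : ℤ, Ioc ((l:ℝ) * Real.pi) ((l + 1) * Real.pi)), ‖φ u‖ₑ * ‖∑ m ∈ M, a m * Complex.exp (Complex.I * (2 * m * u : ℝ))‖ₑ ^ (2:ℕ) := by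
        rw [hU, Measure.restrict_univ]
    _ ≤ ∑' l : ℤ, ∫⁻ u in Ioc ((l:ℝ) * Real.pi) ((l + 1) * Real.pi), ‖φ u‖ₑ * ‖∑ m ∈ M, a m * Complex.exp (Complex.I * (2 * m * u : ℝ))‖ₑ ^ (2:ℕ) := lintegral_iUnion_le _ _
    _ ≤ ∑' l : ℤ, ENNReal.ofReal (ω l) * (ENNReal.ofReal Real.pi * ∑ m ∈ M, ‖a m‖ₑ ^ (2:ℕ)) := by
        refine ENNReal.tsum_le_tsum fun l => ?_
        rw [← trig_interval M a l, ← lintegral_const_mul' _ _ ENNReal.ofReal_ne_top]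
        refine setLIntegral_mono' measurableSet_Ioc fun u hu => ?_
        gcongr
        rw [← ofReal_norm]
        apply ENNReal.ofReal_le_ofReal
        refine (hφ u).trans ?_
        have hp := Real.pi_gt_three
        rcases le_or_gt 0 l with h | h
        · have h' : (0:ℝ) ≤ l := by exact_mod_cast h
          have : (l:ℝ)^2 ≤ u^2 := by
            have := hu.1
            have : (l:ℝ) ≤ u := by nlinarith
            gcongr
          have h3 : c / (1 + u^2) ≤ c * (1 / (1 + (l:ℝ)^2)) := by
            rw [mul_one_div]; gcongr
          have : 0 ≤ c * (1 / (1 + ((l + 1 : ℤ):ℝ) ^ 2)) := by positivity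
          simp only [ω]; linarith
        · have h' : (l:ℝ) + 1 ≤ 0 := by exact_mod_cast h
          have : ((l + 1 : ℤ):ℝ)^2 ≤ u^2 := by
            have := hu.2
            have : u ≤ l + 1 := by nlinarith
            push_cast
            nlinarith
          have h3 : c / (1 + u^2) ≤ c * (1 / (1 + ((l + 1 : ℤ):ℝ)^2)) := by
            rw [mul_one_div]; gcongr
          have : 0 ≤ c * (1 / (1 + (l:ℝ) ^ 2)) := by positivity
          simp only [ω]; linarith
    _ = _ := by rw [ENNReal.tsum_mul_right, mul_assoc]

/-- Hölder for a weighted finite measure. -/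
theorem weighted_holder {w h : ℝ → ℝ≥0∞} (hw : Measurable w) (hh : Measurable h)
    {p q : ℝ} (hp : 0 < p) (hpq : p ≤ q) :
    ∫⁻ u, w u * h u ^ p ≤ (∫⁻ u, w u * h u ^ q) ^ (p / q) * (∫⁻ u, w u) ^ (1 - p / q) := by
  have hq : 0 < q := hp.trans_le hpq
  have := eLpNorm'_le_eLpNorm'_mul_rpow_measure_univ (μ := volume.withDensity w) (f := h) hp hpq
    hh.aestronglyMeasurable
  simp only [eLpNorm', enorm_eq_self] at this
  rw [lintegral_withDensity_eq_lintegral_mul _ hw (hh.pow_const _),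
    lintegral_withDensity_eq_lintegral_mul _ hw (hh.pow_const _),
    withDensity_apply _ MeasurableSet.univ, Measure.restrict_univ] at this
  have h2 := ENNReal.rpow_le_rpow this hp.le
  rw [← ENNReal.rpow_mul, one_div_mul_cancel hp.ne', ENNReal.rpow_one,
    ENNReal.mul_rpow_of_nonneg _ _ hp.le, ← ENNReal.rpow_mul, ← ENNReal.rpow_mul] at h2
  have e1 : 1 / q * p = p / q := by ring
  have e2 : (1 / p - 1 / q) * p = 1 - p / q := by field_simp
  rw [e1, e2] at h2
  exact h2

theorem rpow_sum_le_sum_rpow (M : Finset ℤ) (b : ℤ → ℝ≥0∞) {t : ℝ} (h : 0 < t) (h1 : t ≤ 1) :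
    (∑ m ∈ M, b m) ^ t ≤ ∑ m ∈ M, b m ^ t := by
  classical
  induction M using Finset.induction_on with
  | empty => simp [h]
  | insert m M hm ih =>
    rw [Finset.sum_insert hm, Finset.sum_insert hm]
    exact (ENNReal.rpow_add_le_add_rpow _ _ h.le h1).trans (by gcongr)


/-- `F` is bounded, continuous and reproduced by convolution with the modulated kernel. -/
def ReprK (φ : ℝ → ℂ) (θ : ℝ) (F : ℝ → ℂ) : Prop :=
  Continuous F ∧ (∃ B, ∀ x, ‖F x‖ ≤ B) ∧
    ∀ x, F x = ∫ u, φ u * Complex.exp (Complex.I * (θ * u : ℝ)) * F (x - u)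

theorem norm_exp_I_real (x : ℝ) : ‖Complex.exp (Complex.I * (x : ℂ))‖ = 1 := by
  rw [mul_comm]; exact Complex.norm_exp_ofReal_mul_I x

theorem kernel_integrable {φ : ℝ → ℂ} {c : ℝ} (hφ : Continuous φ)
    (hc : ∀ u, ‖φ u‖ ≤ c / (1 + u ^ 2)) : Integrable φ := by
  have : Integrable (fun u : ℝ => c * (1 + u ^ 2)⁻¹) := integrable_inv_one_add_sq.const_mul c
  refine this.mono' hφ.aestronglyMeasurable (Filter.Eventually.of_forall fun u => ?_)
  rw [← div_eq_mul_inv]; exact hc u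

theorem ReprK.integrable {φ : ℝ → ℂ} (hφ : Continuous φ) (hi : Integrable φ) {θ : ℝ} {F : ℝ → ℂ}
    (h : ReprK φ θ F) (x : ℝ) :
    Integrable (fun u => φ u * Complex.exp (Complex.I * (θ * u : ℝ)) * F (x - u)) := by
  obtain ⟨hF, ⟨B, hB⟩, -⟩ := h
  refine (hi.norm.const_mul B).mono' ?_ (Filter.Eventually.of_forall fun u => ?_)
  · apply Continuous.aestronglyMeasurable; fun_prop
  · rw [norm_mul, norm_mul, norm_exp_I_real, mul_one, mul_comm]
    gcongr
    exact hB _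

theorem ReprK.sum {φ : ℝ → ℂ} (hφ : Continuous φ) (hi : Integrable φ) {θ : ℝ} {ι : Type*}
    (M : Finset ι) (F : ι → ℝ → ℂ) (h : ∀ m ∈ M, ReprK φ θ (F m)) :
    ReprK φ θ (fun x => ∑ m ∈ M, F m x) := by
  refine ⟨continuous_finsetSum _ fun m hm => (h m hm).1, ?_, fun x => ?_⟩
  · classical
    choose! B hB using fun m hm => (h m hm).2.1
    refine ⟨∑ m ∈ M, B m, fun x => (norm_sum_le _ _).trans ?_⟩
    exact Finset.sum_le_sum fun m hm => hB m hm x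
  · simp_rw [Finset.mul_sum]
    rw [integral_finsetSum _ fun m hm => (h m hm).integrable hφ hi x]
    exact Finset.sum_congr rfl fun m hm => (h m hm).2.2 x

theorem orth1D (s : ℝ) (hs1 : 1 ≤ s) (hs2 : s ≤ 2) (φ : ℝ → ℂ) (c : ℝ) (hφ : Continuous φ)
    (hc0 : 0 < c) (hc : ∀ u, ‖φ u‖ ≤ c / (1 + u ^ 2)) :
    ∃ C : ℝ≥0∞, C ≠ ∞ ∧ ∀ (M : Finset ℤ) (d : ℝ) (F : ℤ → ℝ → ℂ),
      (∀ m ∈ M, ReprK φ (2 * m + d) (F m)) →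
      ∫⁻ x, ‖∑ m ∈ M, F m x‖ₑ ^ s ≤ C * ∑ m ∈ M, ∫⁻ x, ‖F m x‖ₑ ^ s := by
  obtain ⟨C1, hC1, hT⟩ := trig_weighted c hc0
  have hi := kernel_integrable hφ hc
  have hs0 : 0 < s := by linarith
  obtain ⟨w, hw⟩ : ∃ w : ℝ → ℝ≥0∞, w = fun u => ‖φ u‖ₑ := ⟨_, rfl⟩
  have hwm : Measurable w := hw ▸ hφ.measurable.enorm
  obtain ⟨N, hN⟩ : ∃ N : ℝ≥0∞, N = ∫⁻ u, w u := ⟨_, rfl⟩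
  have hNt : N ≠ ∞ := by rw [hN, hw]; exact hi.2.ne
  have hd2 : 0 ≤ 1 - s / 2 := by linarith
  have hd1 : 0 ≤ 1 - 1 / s := by
    have : 1 / s ≤ 1 := by rw [div_le_one hs0]; exact hs1
    linarith
  refine ⟨N ^ ((1 - 1 / s) * s) * (C1 ^ (s / 2) * N ^ (1 - s / 2)), ?_, ?_⟩
  · refine ENNReal.mul_ne_top (ENNReal.rpow_ne_top_of_nonneg (by positivity) hNt)
      (ENNReal.mul_ne_top (ENNReal.rpow_ne_top_of_nonneg (by positivity) hC1)
      (ENNReal.rpow_ne_top_of_nonneg hd2 hNt))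
  intro M d F hF
  obtain ⟨Q, hQ⟩ : ∃ Q : ℝ → ℝ → ℝ≥0∞, Q = fun u x => ‖∑ m ∈ M, F m x * Complex.exp (Complex.I * (2 * m * u : ℝ))‖ₑ := ⟨_, rfl⟩
  have hQm : Measurable (fun z : ℝ × ℝ => Q z.1 z.2) := by
    rw [hQ]
    refine Measurable.enorm (Finset.measurable_sum _ fun m hm => ?_)
    have := (hF m hm).1
    apply Continuous.measurable
    fun_prop
  have hQ1 : ∀ x, Measurable (fun u => Q u x) := fun x =>
    hQm.comp (measurable_id.prodMk measurable_const)
  have st1 : ∀ x, ‖∑ m ∈ M, F m x‖ₑ ≤ ∫⁻ u, w u * Q u (x - u) := by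
    intro x
    have : ∑ m ∈ M, F m x = ∫ u, φ u * Complex.exp (Complex.I * (d * u : ℝ)) *
        ∑ m ∈ M, F m (x - u) * Complex.exp (Complex.I * (2 * m * u : ℝ)) := by
      rw [Finset.sum_congr rfl fun m hm => (hF m hm).2.2 x,
        ← integral_finsetSum _ fun m hm => (hF m hm).integrable hφ hi x]
      congr 1; ext u
      rw [Finset.mul_sum]
      refine Finset.sum_congr rfl fun m _ => ?_
      have : Complex.exp (Complex.I * ((2 * m + d) * u : ℝ)) =
          Complex.exp (Complex.I * (d * u : ℝ)) * Complex.exp (Complex.I * (2 * m * u : ℝ)) := by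
        rw [← Complex.exp_add]; congr 1; push_cast; ring
      rw [this]; ring
    rw [this]
    refine (enorm_integral_le_lintegral_enorm _).trans (lintegral_mono fun u => ?_)
    rw [enorm_mul, enorm_mul]
    have : ‖Complex.exp (Complex.I * (d * u : ℝ))‖ₑ = 1 := by
      rw [← ofReal_norm, norm_exp_I_real]; simp
    rw [this, mul_one, hw, hQ]
  have st2 : ∀ x, ‖∑ m ∈ M, F m x‖ₑ ^ s ≤ (∫⁻ u, w u * Q u (x - u) ^ s) * N ^ ((1 - 1 / s) * s) := by
    intro x
    have hm : Measurable (fun u => Q u (x - u)) :=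
      hQm.comp (measurable_id.prodMk (measurable_const.sub measurable_id))
    have h := weighted_holder hwm hm one_pos hs1
    simp only [ENNReal.rpow_one] at h
    rw [← hN] at h
    have h2 := ENNReal.rpow_le_rpow ((st1 x).trans h) hs0.le
    rwa [ENNReal.mul_rpow_of_nonneg _ _ hs0.le, ← ENNReal.rpow_mul, ← ENNReal.rpow_mul,
      one_div_mul_cancel hs0.ne', ENNReal.rpow_one] at h2
  have st3 : ∀ x, ∫⁻ u, w u * Q u x ^ s ≤
      (C1 ^ (s / 2) * N ^ (1 - s / 2)) * ∑ m ∈ M, ‖F m x‖ₑ ^ s := by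
    intro x
    have h := weighted_holder hwm (hQ1 x) hs0 hs2
    rw [← hN] at h
    refine h.trans ?_
    have h3 := hT φ hc M (fun m => F m x)
    have h4 : ∫⁻ u, w u * Q u x ^ (2:ℝ) ≤ C1 * ∑ m ∈ M, ‖F m x‖ₑ ^ (2:ℕ) := by
      simp only [ENNReal.rpow_two, hw, hQ]; exact h3
    calc _ ≤ (C1 * ∑ m ∈ M, ‖F m x‖ₑ ^ (2:ℕ)) ^ (s / 2) * N ^ (1 - s / 2) := by gcongr
      _ = C1 ^ (s / 2) * N ^ (1 - s / 2) * (∑ m ∈ M, ‖F m x‖ₑ ^ (2:ℕ)) ^ (s / 2) := by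
        rw [ENNReal.mul_rpow_of_nonneg _ _ (by positivity)]; ring
      _ ≤ C1 ^ (s / 2) * N ^ (1 - s / 2) * ∑ m ∈ M, (‖F m x‖ₑ ^ (2:ℕ)) ^ (s / 2) := by
        gcongr
        exact rpow_sum_le_sum_rpow _ _ (by positivity) (by linarith)
      _ = _ := by
        congr 1
        refine Finset.sum_congr rfl fun m _ => ?_
        rw [← ENNReal.rpow_two, ← ENNReal.rpow_mul]; congr 1; ring
  calc ∫⁻ x, ‖∑ m ∈ M, F m x‖ₑ ^ s
      ≤ ∫⁻ x, (∫⁻ u, w u * Q u (x - u) ^ s) * N ^ ((1 - 1 / s) * s) := lintegral_mono st2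
    _ = (∫⁻ x, ∫⁻ u, w u * Q u (x - u) ^ s) * N ^ ((1 - 1 / s) * s) := by
        rw [lintegral_mul_const' _ _ (ENNReal.rpow_ne_top_of_nonneg (by positivity) hNt)]
    _ = (∫⁻ u, ∫⁻ x, w u * Q u (x - u) ^ s) * N ^ ((1 - 1 / s) * s) := by
        congr 1
        refine lintegral_lintegral_swap (f := fun x u => w u * Q u (x - u) ^ s) (Measurable.aemeasurable ?_)
        have : Measurable (fun z : ℝ × ℝ => Q z.2 (z.1 - z.2)) :=
          hQm.comp (measurable_snd.prodMk (measurable_fst.sub measurable_snd))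
        exact (hwm.comp measurable_snd).mul (this.pow_const _)
    _ = (∫⁻ u, ∫⁻ x, w u * Q u x ^ s) * N ^ ((1 - 1 / s) * s) := by
        congr 1
        refine lintegral_congr fun u => ?_
        exact lintegral_sub_right_eq_self (fun x => w u * Q u x ^ s) u
    _ = (∫⁻ x, ∫⁻ u, w u * Q u x ^ s) * N ^ ((1 - 1 / s) * s) := by
        congr 1
        refine lintegral_lintegral_swap (f := fun u x => w u * Q u x ^ s) (Measurable.aemeasurable ?_)
        exact (hwm.comp measurable_fst).mul (hQm.pow_const _)
    _ ≤ (∫⁻ x, (C1 ^ (s / 2) * N ^ (1 - s / 2)) * ∑ m ∈ M, ‖F m x‖ₑ ^ s) * N ^ ((1 - 1 / s) * s) := by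
        gcongr with x
        exact st3 x
    _ = _ := by
        have hm : ∀ m ∈ M, Measurable (fun x => ‖F m x‖ₑ ^ s) := fun m hm =>
          ((hF m hm).1.measurable.enorm).pow_const _
        rw [lintegral_const_mul _ (Finset.measurable_sum _ hm), lintegral_finsetSum _ hm]
        ring


theorem repr_of_integral {φ : ℝ → ℂ} (hφ : Continuous φ) (hi : Integrable φ)
    (hrep : ∀ θ : ℝ, |θ| ≤ 1 → ∫ u : ℝ, φ u * Complex.exp (-Complex.I * (u * θ : ℝ)) = 1)
    {Z : Type*} [MeasurableSpace Z] (μ : Measure Z) [SFinite μ] (h : Z → ℂ) (hh : Integrable h μ)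
    (θ : Z → ℝ) (hθ : Measurable θ) (θ₀ : ℝ) (hsupp : ∀ z, h z ≠ 0 → |θ z - θ₀| ≤ 1) :
    ReprK φ θ₀ (fun x => ∫ z, Complex.exp (Complex.I * (x * θ z : ℝ)) * h z ∂μ) := by
  have hm : ∀ x : ℝ, AEStronglyMeasurable (fun z => Complex.exp (Complex.I * (x * θ z : ℝ))) μ := by
    intro x
    apply Measurable.aestronglyMeasurable
    fun_prop
  refine ⟨?_, ⟨∫ z, ‖h z‖ ∂μ, fun x => ?_⟩, fun x => ?_⟩
  · refine continuous_of_dominated (bound := fun z => ‖h z‖) (fun x => (hm x).mul hh.1)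
      (fun x => Filter.Eventually.of_forall fun z => ?_) hh.norm
      (Filter.Eventually.of_forall fun z => by fun_prop)
    rw [norm_mul, norm_exp_I_real, one_mul]
  · refine (norm_integral_le_integral_norm _).trans (le_of_eq ?_)
    congr 1; ext z
    rw [norm_mul, norm_exp_I_real, one_mul]
  · have e1 : ∀ u : ℝ, φ u * Complex.exp (Complex.I * (θ₀ * u : ℝ)) *
        ∫ z, Complex.exp (Complex.I * ((x - u) * θ z : ℝ)) * h z ∂μ =
        ∫ z, φ u * Complex.exp (Complex.I * (θ₀ * u : ℝ)) *
          (Complex.exp (Complex.I * ((x - u) * θ z : ℝ)) * h z) ∂μ := fun u =>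
      (integral_const_mul _ _).symm
    simp_rw [e1]
    rw [integral_integral_swap]
    · congr 1; ext z
      by_cases hz : h z = 0
      · simp [hz]
      · have e2 : ∀ u : ℝ, φ u * Complex.exp (Complex.I * (θ₀ * u : ℝ)) *
          (Complex.exp (Complex.I * ((x - u) * θ z : ℝ)) * h z) =
          (φ u * Complex.exp (-Complex.I * (u * (θ z - θ₀) : ℝ))) *
            (Complex.exp (Complex.I * (x * θ z : ℝ)) * h z) := by
          intro u
          have : Complex.exp (Complex.I * (θ₀ * u : ℝ)) * Complex.exp (Complex.I * ((x - u) * θ z : ℝ))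
            = Complex.exp (-Complex.I * (u * (θ z - θ₀) : ℝ)) * Complex.exp (Complex.I * (x * θ z : ℝ)) := by
            rw [← Complex.exp_add, ← Complex.exp_add]; congr 1; push_cast; ring
          linear_combination (φ u * h z) * this
        simp_rw [e2]
        rw [integral_mul_const, hrep _ (hsupp z hz), one_mul]
    · have hp : Integrable (fun q : ℝ × Z => φ q.1 * h q.2) (volume.prod μ) := hi.mul_prod hh
      refine hp.norm.mono' ?_ (Filter.Eventually.of_forall fun q => ?_)
      · have : AEStronglyMeasurable (fun q : ℝ × Z => (Complex.exp (Complex.I * (θ₀ * q.1 : ℝ)) *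
          Complex.exp (Complex.I * ((x - q.1) * θ q.2 : ℝ))) * (φ q.1 * h q.2)) (volume.prod μ) := by
          refine AEStronglyMeasurable.mul ?_ hp.1
          apply Measurable.aestronglyMeasurable
          fun_prop
        refine this.congr (Filter.Eventually.of_forall fun q => ?_)
        simp only [Function.uncurry]
        ring
      · simp only [Function.uncurry, norm_mul, norm_exp_I_real, mul_one, one_mul]
        exact le_refl _

theorem extOp_integrand_integrable {f : ℝ × ℝ → ℂ} (hf : Integrable f) (p : ℝ × ℝ × ℝ) :
    Integrable (fun ξ : ℝ × ℝ =>
      Complex.exp (Complex.I * (p.1 * ξ.1 * ξ.2 + p.2.1 * ξ.1 + p.2.2 * ξ.2 : ℝ)) * f ξ) := by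
  refine hf.norm.mono' ?_ (Filter.Eventually.of_forall fun ξ => ?_)
  · refine AEStronglyMeasurable.mul ?_ hf.1
    apply Continuous.aestronglyMeasurable; fun_prop
  · rw [norm_mul, norm_exp_I_real, one_mul]

theorem extOp_continuous {f : ℝ × ℝ → ℂ} (hf : Integrable f) : Continuous (extOp f) := by
  refine continuous_of_dominated (bound := fun z => ‖f z‖)
    (fun p => (extOp_integrand_integrable hf p).1)
    (fun x => Filter.Eventually.of_forall fun z => ?_) hf.norm
    (Filter.Eventually.of_forall fun z => by fun_prop)
  rw [norm_mul, norm_exp_I_real, one_mul]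

theorem extOp_mul {f g : ℝ × ℝ → ℂ} (p : ℝ × ℝ × ℝ) :
    extOp f p * extOp g p = ∫ z : (ℝ × ℝ) × (ℝ × ℝ),
      (Complex.exp (Complex.I * (p.1 * z.1.1 * z.1.2 + p.2.1 * z.1.1 + p.2.2 * z.1.2 : ℝ)) * f z.1) *
      (Complex.exp (Complex.I * (p.1 * z.2.1 * z.2.2 + p.2.1 * z.2.1 + p.2.2 * z.2.2 : ℝ)) * g z.2) := by
  unfold extOp
  rw [← integral_prod_mul]; rfl

/-- Reproducing property in the first space variable. -/
theorem repr_fst {φ : ℝ → ℂ} (hφ : Continuous φ) (hi : Integrable φ)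
    (hrep : ∀ θ : ℝ, |θ| ≤ 1 → ∫ u : ℝ, φ u * Complex.exp (-Complex.I * (u * θ : ℝ)) = 1)
    {f g : ℝ × ℝ → ℂ} (hf : Integrable f) (hg : Integrable g) (a b : ℝ)
    (hfs : ∀ ξ, f ξ ≠ 0 → ξ.1 ∈ Icc a (a + 1)) (hgs : ∀ ξ, g ξ ≠ 0 → ξ.1 ∈ Icc b (b + 1))
    (t x₂ : ℝ) :
    ReprK φ (a + b + 1) (fun x => extOp f (t, x, x₂) * extOp g (t, x, x₂)) := by
  have hI : Integrable (fun z : (ℝ × ℝ) × (ℝ × ℝ) => 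
      (Complex.exp (Complex.I * (t * z.1.1 * z.1.2 + 0 * z.1.1 + x₂ * z.1.2 : ℝ)) * f z.1) *
      (Complex.exp (Complex.I * (t * z.2.1 * z.2.2 + 0 * z.2.1 + x₂ * z.2.2 : ℝ)) * g z.2)) :=
    (extOp_integrand_integrable hf (t, 0, x₂)).mul_prod (extOp_integrand_integrable hg (t, 0, x₂))
  have := repr_of_integral hφ hi hrep volume _ hI (fun z => z.1.1 + z.2.1) (by fun_prop) (a + b + 1) ?_
  · convert this using 2 with x
    rw [extOp_mul]
    congr 1; ext z
    have e : Complex.exp (Complex.I * (t * z.1.1 * z.1.2 + x * z.1.1 + x₂ * z.1.2 : ℝ)) *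
      Complex.exp (Complex.I * (t * z.2.1 * z.2.2 + x * z.2.1 + x₂ * z.2.2 : ℝ)) =
      Complex.exp (Complex.I * (x * (z.1.1 + z.2.1) : ℝ)) * (
      Complex.exp (Complex.I * (t * z.1.1 * z.1.2 + 0 * z.1.1 + x₂ * z.1.2 : ℝ)) *
      Complex.exp (Complex.I * (t * z.2.1 * z.2.2 + 0 * z.2.1 + x₂ * z.2.2 : ℝ))) := by
      rw [← Complex.exp_add, ← Complex.exp_add, ← Complex.exp_add]; congr 1; push_cast; ring
    linear_combination (f z.1 * g z.2) * e
  · intro z hz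
    have h1 := hfs z.1 (fun h => hz (by simp [h]))
    have h2 := hgs z.2 (fun h => hz (by simp [h]))
    rw [abs_le]
    constructor <;> linarith [h1.1, h1.2, h2.1, h2.2]

/-- Reproducing property in the second space variable. -/
theorem repr_snd {φ : ℝ → ℂ} (hφ : Continuous φ) (hi : Integrable φ)
    (hrep : ∀ θ : ℝ, |θ| ≤ 1 → ∫ u : ℝ, φ u * Complex.exp (-Complex.I * (u * θ : ℝ)) = 1)
    {f g : ℝ × ℝ → ℂ} (hf : Integrable f) (hg : Integrable g) (a b : ℝ)
    (hfs : ∀ ξ, f ξ ≠ 0 → ξ.2 ∈ Icc a (a + 1)) (hgs : ∀ ξ, g ξ ≠ 0 → ξ.2 ∈ Icc b (b + 1))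
    (t x₁ : ℝ) :
    ReprK φ (a + b + 1) (fun x => extOp f (t, x₁, x) * extOp g (t, x₁, x)) := by
  have hI : Integrable (fun z : (ℝ × ℝ) × (ℝ × ℝ) => 
      (Complex.exp (Complex.I * (t * z.1.1 * z.1.2 + x₁ * z.1.1 + 0 * z.1.2 : ℝ)) * f z.1) *
      (Complex.exp (Complex.I * (t * z.2.1 * z.2.2 + x₁ * z.2.1 + 0 * z.2.2 : ℝ)) * g z.2)) :=
    (extOp_integrand_integrable hf (t, x₁, 0)).mul_prod (extOp_integrand_integrable hg (t, x₁, 0))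
  have := repr_of_integral hφ hi hrep volume _ hI (fun z => z.1.2 + z.2.2) (by fun_prop) (a + b + 1) ?_
  · convert this using 2 with x
    rw [extOp_mul]
    congr 1; ext z
    have e : Complex.exp (Complex.I * (t * z.1.1 * z.1.2 + x₁ * z.1.1 + x * z.1.2 : ℝ)) *
      Complex.exp (Complex.I * (t * z.2.1 * z.2.2 + x₁ * z.2.1 + x * z.2.2 : ℝ)) =
      Complex.exp (Complex.I * (x * (z.1.2 + z.2.2) : ℝ)) * (
      Complex.exp (Complex.I * (t * z.1.1 * z.1.2 + x₁ * z.1.1 + 0 * z.1.2 : ℝ)) *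
      Complex.exp (Complex.I * (t * z.2.1 * z.2.2 + x₁ * z.2.1 + 0 * z.2.2 : ℝ))) := by
      rw [← Complex.exp_add, ← Complex.exp_add, ← Complex.exp_add]; congr 1; push_cast; ring
    linear_combination (f z.1 * g z.2) * e
  · intro z hz
    have h1 := hfs z.1 (fun h => hz (by simp [h]))
    have h2 := hgs z.2 (fun h => hz (by simp [h]))
    rw [abs_le]
    constructor <;> linarith [h1.1, h1.2, h2.1, h2.2]


theorem fub1 {h : ℝ × ℝ × ℝ → ℝ≥0∞} (hh : Measurable h) :
    ∫⁻ p, h p = ∫⁻ t, ∫⁻ x₂, ∫⁻ x₁, h (t, x₁, x₂) := by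
  rw [Measure.volume_eq_prod, lintegral_prod _ hh.aemeasurable]
  refine lintegral_congr fun t => ?_
  rw [Measure.volume_eq_prod, lintegral_prod_symm _ (by fun_prop)]

theorem fub2 {h : ℝ × ℝ × ℝ → ℝ≥0∞} (hh : Measurable h) :
    ∫⁻ p, h p = ∫⁻ t, ∫⁻ x₁, ∫⁻ x₂, h (t, x₁, x₂) := by
  rw [Measure.volume_eq_prod, lintegral_prod _ hh.aemeasurable]
  refine lintegral_congr fun t => ?_
  rw [Measure.volume_eq_prod, lintegral_prod _ (by fun_prop)]

theorem fubsum1 {h : ℤ → ℝ × ℝ × ℝ → ℝ≥0∞} (hh : ∀ m, Measurable (h m)) {C : ℝ≥0∞} (hC : C ≠ ∞)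
    (M : Finset ℤ) :
    ∫⁻ t, ∫⁻ x₂, C * ∑ m ∈ M, ∫⁻ x₁, h m (t, x₁, x₂) = C * ∑ m ∈ M, ∫⁻ p, h m p := by
  have hm' : ∀ m, Measurable (fun q : ℝ × ℝ => ∫⁻ y, h m (q.1, y, q.2)) := by
    intro m
    refine Measurable.lintegral_prod_right' (f := fun z : (ℝ × ℝ) × ℝ => h m (z.1.1, z.2, z.1.2)) ?_
    exact (hh m).comp (by fun_prop)
  have hm2 : ∀ t m, Measurable (fun x₂ => ∫⁻ x₁, h m (t, x₁, x₂)) := fun t m =>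
    (hm' m).comp (measurable_prodMk_left (x := t))
  have hm3 : ∀ m, Measurable (fun t => ∫⁻ x₂, ∫⁻ x₁, h m (t, x₁, x₂)) := fun m =>
    Measurable.lintegral_prod_right' (hm' m)
  have e1 : ∀ t, ∫⁻ x₂, C * ∑ m ∈ M, ∫⁻ x₁, h m (t, x₁, x₂) =
      C * ∑ m ∈ M, ∫⁻ x₂, ∫⁻ x₁, h m (t, x₁, x₂) := by
    intro t
    rw [lintegral_const_mul' _ _ hC, lintegral_finsetSum _ fun m _ => hm2 t m]
  simp_rw [e1]
  rw [lintegral_const_mul' _ _ hC, lintegral_finsetSum _ fun m _ => hm3 m]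
  congr 1
  exact Finset.sum_congr rfl fun m _ => (fub1 (hh m)).symm

theorem fubsum2 {h : ℤ → ℝ × ℝ × ℝ → ℝ≥0∞} (hh : ∀ m, Measurable (h m)) {C : ℝ≥0∞} (hC : C ≠ ∞)
    (M : Finset ℤ) :
    ∫⁻ t, ∫⁻ x₁, C * ∑ m ∈ M, ∫⁻ x₂, h m (t, x₁, x₂) = C * ∑ m ∈ M, ∫⁻ p, h m p := by
  have hm' : ∀ m, Measurable (fun q : ℝ × ℝ => ∫⁻ y, h m (q.1, q.2, y)) := by
    intro m
    refine Measurable.lintegral_prod_right' (f := fun z : (ℝ × ℝ) × ℝ => h m (z.1.1, z.1.2, z.2)) ?_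
    exact (hh m).comp (by fun_prop)
  have hm2 : ∀ t m, Measurable (fun x₁ => ∫⁻ x₂, h m (t, x₁, x₂)) := fun t m =>
    (hm' m).comp (measurable_prodMk_left (x := t))
  have hm3 : ∀ m, Measurable (fun t => ∫⁻ x₁, ∫⁻ x₂, h m (t, x₁, x₂)) := fun m =>
    Measurable.lintegral_prod_right' (hm' m)
  have e1 : ∀ t, ∫⁻ x₁, C * ∑ m ∈ M, ∫⁻ x₂, h m (t, x₁, x₂) =
      C * ∑ m ∈ M, ∫⁻ x₁, ∫⁻ x₂, h m (t, x₁, x₂) := by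
    intro t
    rw [lintegral_const_mul' _ _ hC, lintegral_finsetSum _ fun m _ => hm2 t m]
  simp_rw [e1]
  rw [lintegral_const_mul' _ _ hC, lintegral_finsetSum _ fun m _ => hm3 m]
  congr 1
  exact Finset.sum_congr rfl fun m _ => (fub2 (hh m)).symm

theorem orth2D (s : ℝ) (hs1 : 1 ≤ s) (hs2 : s ≤ 2) :
    ∃ C : ℝ≥0∞, C ≠ ∞ ∧ ∀ (M₁ M₂ : Finset ℤ) (d e : ℤ) (f g : ℤ → ℤ → ℝ × ℝ → ℂ),
      (∀ m n, Integrable (f m n)) → (∀ m n, Integrable (g m n)) →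
      (∀ m n ξ, f m n ξ ≠ 0 → ξ ∈ unitSq m n) →
      (∀ m n ξ, g m n ξ ≠ 0 → ξ ∈ unitSq (m + d : ℤ) (n + e : ℤ)) →
      ∫⁻ p, ‖∑ m ∈ M₁, ∑ n ∈ M₂, extOp (f m n) p * extOp (g m n) p‖ₑ ^ s ≤
        C * ∑ m ∈ M₁, ∑ n ∈ M₂, ∫⁻ p, ‖extOp (f m n) p * extOp (g m n) p‖ₑ ^ s := by
  obtain ⟨φ, c, hφ, hc0, hc, hrep⟩ := exists_kernel
  obtain ⟨C, hC, hO⟩ := orth1D s hs1 hs2 φ c hφ hc0 hc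
  have hi := kernel_integrable hφ hc
  refine ⟨C * C, ENNReal.mul_ne_top hC hC, ?_⟩
  intro M₁ M₂ d e f g hf hg hfs hgs
  have hcf := fun m n => extOp_continuous (hf m n)
  have hcg := fun m n => extOp_continuous (hg m n)
  have h1 : ∫⁻ p, ‖∑ m ∈ M₁, ∑ n ∈ M₂, extOp (f m n) p * extOp (g m n) p‖ₑ ^ s ≤
      C * ∑ m ∈ M₁, ∫⁻ p, ‖∑ n ∈ M₂, extOp (f m n) p * extOp (g m n) p‖ₑ ^ s := by
    have hm : ∀ m, Measurable (fun p => ‖∑ n ∈ M₂, extOp (f m n) p * extOp (g m n) p‖ₑ ^ s) := by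
      intro m
      refine Measurable.pow_const (Measurable.enorm (Continuous.measurable ?_)) _
      fun_prop
    rw [fub1]
    · calc _ ≤ ∫⁻ t, ∫⁻ x₂, C * ∑ m ∈ M₁, ∫⁻ x₁, ‖∑ n ∈ M₂, extOp (f m n) (t, x₁, x₂) * extOp (g m n) (t, x₁, x₂)‖ₑ ^ s := by
            refine lintegral_mono fun t => lintegral_mono fun x₂ => ?_
            refine hO M₁ (d + 1) (fun m x₁ => ∑ n ∈ M₂, extOp (f m n) (t, x₁, x₂) * extOp (g m n) (t, x₁, x₂)) ?_
            intro m _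
            refine ReprK.sum hφ hi _ _ fun n _ => ?_
            have := repr_fst hφ hi hrep (hf m n) (hg m n) m (m + d : ℤ)
              (fun ξ h => (hfs m n ξ h).1) (fun ξ h => (hgs m n ξ h).1) t x₂
            convert this using 1
            push_cast; ring
        _ = _ := by
            exact fubsum1 hm hC M₁
    · refine Measurable.pow_const (Measurable.enorm (Continuous.measurable ?_)) _
      fun_prop
  have h2 : ∀ m, ∫⁻ p, ‖∑ n ∈ M₂, extOp (f m n) p * extOp (g m n) p‖ₑ ^ s ≤
      C * ∑ n ∈ M₂, ∫⁻ p, ‖extOp (f m n) p * extOp (g m n) p‖ₑ ^ s := by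
    intro m
    have hm : ∀ n, Measurable (fun p => ‖extOp (f m n) p * extOp (g m n) p‖ₑ ^ s) := by
      intro m
      refine Measurable.pow_const (Measurable.enorm (Continuous.measurable ?_)) _
      fun_prop
    rw [fub2]
    · calc _ ≤ ∫⁻ t, ∫⁻ x₁, C * ∑ n ∈ M₂, ∫⁻ x₂, ‖extOp (f m n) (t, x₁, x₂) * extOp (g m n) (t, x₁, x₂)‖ₑ ^ s := by
            refine lintegral_mono fun t => lintegral_mono fun x₁ => ?_
            refine hO M₂ (e + 1) (fun n x₂ => extOp (f m n) (t, x₁, x₂) * extOp (g m n) (t, x₁, x₂)) ?_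
            intro n _
            have := repr_snd hφ hi hrep (hf m n) (hg m n) n (n + e : ℤ)
              (fun ξ h => (hfs m n ξ h).2) (fun ξ h => (hgs m n ξ h).2) t x₁
            convert this using 1
            push_cast; ring
        _ = _ := by
            exact fubsum2 hm hC M₂
    · refine Measurable.pow_const (Measurable.enorm (Continuous.measurable ?_)) _
      fun_prop
  refine h1.trans ?_
  rw [mul_assoc, Finset.mul_sum (a := C) (s := M₁) (f := fun m => ∑ n ∈ M₂, _)]
  gcongr with m _
  exact h2 m


/-- Half-open unit tile with integer corner. -/
def utile (m n : ℤ) : Set (ℝ × ℝ) := {ξ | ⌊ξ.1⌋ = m ∧ ⌊ξ.2⌋ = n}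

theorem measurableSet_utile (m n : ℤ) : MeasurableSet (utile m n) := by
  have h1 : Measurable (fun ξ : ℝ × ℝ => ⌊ξ.1⌋) := Int.measurable_floor.comp measurable_fst
  have h2 : Measurable (fun ξ : ℝ × ℝ => ⌊ξ.2⌋) := Int.measurable_floor.comp measurable_snd
  exact (h1 (measurableSet_singleton m)).inter (h2 (measurableSet_singleton n))

theorem utile_subset (m n : ℤ) : utile m n ⊆ unitSq m n := by
  rintro ξ ⟨h1, h2⟩
  rw [Int.floor_eq_iff] at h1 h2
  exact ⟨⟨h1.1, h1.2.le⟩, ⟨h2.1, h2.2.le⟩⟩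

theorem volume_unitSq (a b : ℝ) : volume (unitSq a b) = 1 := by
  rw [unitSq, Measure.volume_eq_prod, Measure.prod_prod]; simp

theorem chi_integrable {E : Set (ℝ × ℝ)} (hE : MeasurableSet E) (h : volume E ≠ ∞) :
    Integrable (chi E) := by
  unfold chi
  rw [integrable_indicator_iff hE]
  exact integrableOn_const h

theorem chi_ne_zero {E : Set (ℝ × ℝ)} {ξ : ℝ × ℝ} (h : chi E ξ ≠ 0) : ξ ∈ E := by
  by_contra hn
  exact h (by simp [chi, hn])

theorem eLpNorm_chi_le {E : Set (ℝ × ℝ)} (hE : MeasurableSet E) (h : volume E ≤ 1) (r : ℝ) :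
    eLpNorm (chi E) (ENNReal.ofReal r) volume ≤ volume E ^ (1 / max r 1) := by
  rcases le_or_gt r 0 with hr | hr
  · rw [ENNReal.ofReal_of_nonpos hr]; simp
  · unfold chi
    rw [eLpNorm_indicator_const hE (by simpa using hr) ENNReal.ofReal_ne_top,
      ENNReal.toReal_ofReal hr.le]
    simp only [enorm_one, one_mul]
    apply ENNReal.rpow_le_rpow_of_exponent_ge h
    gcongr
    exact le_max_left _ _

theorem sum_utile_le {W : Set (ℝ × ℝ)} (hW : MeasurableSet W) (M₁ M₂ : Finset ℤ) (d e : ℤ) :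
    ∑ m ∈ M₁, ∑ n ∈ M₂, volume (W ∩ utile (m + d) (n + e)) ≤ volume W := by
  rw [← Finset.sum_product', ← measure_biUnion_finset]
  · apply measure_mono
    simp only [iUnion_subset_iff]
    exact fun _ _ => inter_subset_left
  · rintro q - q' - hne
    refine Set.disjoint_left.mpr ?_
    rintro ξ ⟨-, h1, h2⟩ ⟨-, h3, h4⟩
    apply hne
    ext <;> omega
  · exact fun q _ => hW.inter (measurableSet_utile _ _)

theorem unit_est (s r A : ℝ) (hs1 : 1 ≤ s) (hs2 : s ≤ 2) (hrs : max r 1 ≤ 2 * s)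
    (hBH : BH s r A) :
    ∃ C : ℝ≥0∞, C ≠ ∞ ∧ ∀ (W : Set (ℝ × ℝ)), MeasurableSet W → ∀ (M₁ M₂ : Finset ℤ)
      (d e : ℤ), 2 ≤ |d| → |d| ≤ 5 → 2 ≤ |e| → |e| ≤ 5 → ∀ μ : ℝ≥0∞,
      (∀ m n, volume (W ∩ utile m n) ≤ μ) →
      ∫⁻ p, ‖∑ m ∈ M₁, ∑ n ∈ M₂, extOp (chi (W ∩ utile m n)) p *
        extOp (chi (W ∩ utile (m + d) (n + e))) p‖ₑ ^ s ≤
      C * (μ ^ (2 * s / max r 1 - 1) * volume W) := by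
  obtain ⟨C, hC, hO⟩ := orth2D s hs1 hs2
  have hs0 : 0 < s := by linarith
  have hR : 0 < max r 1 := lt_max_of_lt_right one_pos
  obtain ⟨R, hRd⟩ : ∃ R, R = max r 1 := ⟨_, rfl⟩
  rw [← hRd] at hR hrs ⊢
  refine ⟨C * (ENNReal.ofReal A ^ s * 2), by finiteness, ?_⟩
  intro W hW M₁ M₂ d e hd1 hd2 he1 he2 μ hμ
  have hE : ∀ m n, MeasurableSet (W ∩ utile m n) := fun m n => hW.inter (measurableSet_utile _ _)
  have hv1 : ∀ m n, volume (W ∩ utile m n) ≤ 1 := fun m n => by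
    rw [← volume_unitSq m n]
    exact measure_mono (inter_subset_right.trans (utile_subset _ _))
  have hIntg : ∀ m n, Integrable (chi (W ∩ utile m n)) := fun m n =>
    chi_integrable (hE m n) ((hv1 m n).trans_lt ENNReal.one_lt_top).ne
  have hsup : ∀ m n ξ, chi (W ∩ utile m n) ξ ≠ 0 → ξ ∈ unitSq m n := fun m n ξ h =>
    utile_subset _ _ (chi_ne_zero h).2
  refine (hO M₁ M₂ d e (fun m n => chi (W ∩ utile m n))
    (fun m n => chi (W ∩ utile (m + d) (n + e))) (fun m n => hIntg _ _) (fun m n => hIntg _ _)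
    (fun m n ξ h => hsup _ _ _ h) (fun m n ξ h => hsup _ _ _ h)).trans ?_
  rw [mul_assoc C]
  gcongr
  have hq : 0 ≤ 2 * s / R - 1 := by
    rw [sub_nonneg, le_div_iff₀ hR, one_mul]; exact hrs
  have key : ∀ m n, ∫⁻ p, ‖extOp (chi (W ∩ utile m n)) p *
      extOp (chi (W ∩ utile (m + d) (n + e))) p‖ₑ ^ s ≤
      ENNReal.ofReal A ^ s * μ ^ (2 * s / R - 1) *
        (volume (W ∩ utile (m + 0) (n + 0)) + volume (W ∩ utile (m + d) (n + e))) := by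
    intro m n
    have hb := hBH m n (m + d : ℤ) (n + e : ℤ) (by push_cast; simp only [sub_add_cancel_left, abs_neg]; exact_mod_cast hd1)
      (by push_cast; simp only [sub_add_cancel_left, abs_neg]; exact_mod_cast hd2)
      (by push_cast; simp only [sub_add_cancel_left, abs_neg]; exact_mod_cast he1)
      (by push_cast; simp only [sub_add_cancel_left, abs_neg]; exact_mod_cast he2)
      (chi (W ∩ utile m n)) (chi (W ∩ utile (m + d) (n + e)))
      (fun ξ h => hsup _ _ _ h) (fun ξ h => hsup _ _ _ h)
    have hb2 := hb.trans (mul_le_mul' (mul_le_mul' le_rfl (eLpNorm_chi_le (hE _ _) (hv1 _ _) r))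
      (eLpNorm_chi_le (hE _ _) (hv1 _ _) r))
    rw [eLpNorm_eq_lintegral_rpow_enorm_toReal (by simpa using hs0) ENNReal.ofReal_ne_top,
      ENNReal.toReal_ofReal hs0.le, ← hRd] at hb2
    have hb3 := ENNReal.rpow_le_rpow hb2 hs0.le
    rw [← ENNReal.rpow_mul, one_div_mul_cancel hs0.ne', ENNReal.rpow_one] at hb3
    refine hb3.trans ?_
    rw [add_zero, add_zero]
    set v := volume (W ∩ utile m n)
    set v' := volume (W ∩ utile (m + d) (n + e))
    rw [ENNReal.mul_rpow_of_nonneg _ _ hs0.le, ENNReal.mul_rpow_of_nonneg _ _ hs0.le, mul_assoc,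
      mul_assoc]
    refine mul_le_mul' le_rfl ?_
    rw [← ENNReal.rpow_mul, ← ENNReal.rpow_mul]
    have hx : 0 ≤ 1 / R * s := by positivity
    have h2 : ∀ x : ℝ≥0∞, x ≤ μ → x ^ (1 / R * s) * x ^ (1 / R * s) ≤ μ ^ (2 * s / R - 1) * x := by
      intro x hx'
      rw [← ENNReal.rpow_add_of_nonneg _ _ hx hx]
      have : 1 / R * s + 1 / R * s = (2 * s / R - 1) + 1 := by ring
      rw [this, ENNReal.rpow_add_of_nonneg _ _ hq zero_le_one, ENNReal.rpow_one]
      gcongr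
    rcases le_total v v' with h | h
    · calc _ ≤ v' ^ (1 / R * s) * v' ^ (1 / R * s) := by gcongr
        _ ≤ μ ^ (2 * s / R - 1) * v' := h2 _ (hμ _ _)
        _ ≤ _ := by gcongr; exact le_add_self
    · calc _ ≤ v ^ (1 / R * s) * v ^ (1 / R * s) := by gcongr
        _ ≤ μ ^ (2 * s / R - 1) * v := h2 _ (hμ _ _)
        _ ≤ _ := by gcongr; exact le_self_add
  calc _ ≤ ∑ m ∈ M₁, ∑ n ∈ M₂, ENNReal.ofReal A ^ s * μ ^ (2 * s / R - 1) *
        (volume (W ∩ utile (m + 0) (n + 0)) + volume (W ∩ utile (m + d) (n + e))) :=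
        Finset.sum_le_sum fun m _ => Finset.sum_le_sum fun n _ => key m n
    _ = ENNReal.ofReal A ^ s * μ ^ (2 * s / R - 1) *
        (∑ m ∈ M₁, ∑ n ∈ M₂, volume (W ∩ utile (m + 0) (n + 0)) + 
          ∑ m ∈ M₁, ∑ n ∈ M₂, volume (W ∩ utile (m + d) (n + e))) := by
        simp_rw [← Finset.mul_sum, Finset.sum_add_distrib]
    _ ≤ ENNReal.ofReal A ^ s * μ ^ (2 * s / R - 1) * (volume W + volume W) := by
        gcongr
        · exact sum_utile_le hW _ _ _ _
        · exact sum_utile_le hW _ _ _ _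
    _ = _ := by ring


/-- Anisotropic dilation of the plane. -/
def dil (c d : ℝ) (ξ : ℝ × ℝ) : ℝ × ℝ := (c * ξ.1, d * ξ.2)

theorem measurable_dil (c d : ℝ) : Measurable (dil c d) := by unfold dil; fun_prop

theorem map_dil {c d : ℝ} (hc : 0 < c) (hd : 0 < d) :
    Measure.map (dil c d) volume = ENNReal.ofReal ((c * d)⁻¹) • volume := by
  have h1 := Real.map_volume_mul_left hc.ne'
  have h2 := Real.map_volume_mul_left hd.ne'
  have h3 : dil c d = Prod.map (c * ·) (d * ·) := by ext ξ <;> rfl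
  rw [h3, Measure.volume_eq_prod, ← Measure.map_prod_map _ _ (by fun_prop) (by fun_prop), h1, h2,
    Measure.prod_smul_left, Measure.prod_smul_right, smul_smul, ← ENNReal.ofReal_mul (abs_nonneg _),
    ← abs_mul, ← mul_inv, abs_of_pos (by positivity)]

/-- The corresponding dilation of space-time. -/
def dil3 (c d : ℝ) (p : ℝ × ℝ × ℝ) : ℝ × ℝ × ℝ := (c * d * p.1, c * p.2.1, d * p.2.2)

theorem map_dil3 {c d : ℝ} (hc : 0 < c) (hd : 0 < d) :
    Measure.map (dil3 c d) volume = (ENNReal.ofReal ((c * d)⁻¹) * ENNReal.ofReal ((c * d)⁻¹)) • volume := by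
  have h1 := Real.map_volume_mul_left (mul_pos hc hd).ne'
  have h3 : dil3 c d = Prod.map (c * d * ·) (dil c d) := by ext ξ <;> rfl
  rw [h3, Measure.volume_eq_prod, ← Measure.map_prod_map _ _ (by fun_prop) (measurable_dil c d), h1, map_dil hc hd,
    Measure.prod_smul_left, Measure.prod_smul_right, smul_smul, abs_of_pos (by positivity)]

theorem extOp_dil {c d : ℝ} (hc : 0 < c) (hd : 0 < d) {E : Set (ℝ × ℝ)} (hE : MeasurableSet E)
    (p : ℝ × ℝ × ℝ) :
    extOp (chi E) p = (c * d : ℝ) * extOp (chi (dil c d ⁻¹' E)) (dil3 c d p) := by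
  have hm : Measurable (chi E) := measurable_const.indicator hE
  have h := integral_map (μ := (volume : Measure (ℝ × ℝ))) (φ := dil c d) (measurable_dil c d).aemeasurable
    (f := fun ξ => Complex.exp (Complex.I * (p.1 * ξ.1 * ξ.2 + p.2.1 * ξ.1 + p.2.2 * ξ.2 : ℝ)) * chi E ξ)
    (by apply Measurable.aestronglyMeasurable; fun_prop)
  rw [map_dil hc hd, integral_smul_measure, ENNReal.toReal_ofReal (by positivity)] at h
  have h2 : extOp (chi (dil c d ⁻¹' E)) (dil3 c d p) = ((c * d)⁻¹ : ℝ) • extOp (chi E) p := by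
    rw [extOp, extOp, h]
    refine integral_congr_ae (Filter.Eventually.of_forall fun ξ => ?_)
    simp only [dil3, dil]
    congr 1
    congr 2
    push_cast
    ring
  rw [h2, Complex.real_smul, ← mul_assoc, ← Complex.ofReal_mul, mul_inv_cancel₀ (by positivity)]
  simp

/-- Scaled tile. -/
def stile (c d : ℝ) (m n : ℤ) : Set (ℝ × ℝ) := {ξ | ⌊c⁻¹ * ξ.1⌋ = m ∧ ⌊d⁻¹ * ξ.2⌋ = n}

theorem stile_eq (c d : ℝ) (m n : ℤ) : stile c d m n = dil c⁻¹ d⁻¹ ⁻¹' utile m n := rfl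

theorem measurableSet_stile (c d : ℝ) (m n : ℤ) : MeasurableSet (stile c d m n) :=
  measurable_dil _ _ (measurableSet_utile m n)

theorem dil_stile {c d : ℝ} (hc : 0 < c) (hd : 0 < d) (m n : ℤ) :
    dil c d ⁻¹' stile c d m n = utile m n := by
  ext ξ
  simp [dil, stile, utile, inv_mul_cancel_left₀ hc.ne', inv_mul_cancel_left₀ hd.ne']

theorem volume_dil {c d : ℝ} (hc : 0 < c) (hd : 0 < d) {E : Set (ℝ × ℝ)} (hE : MeasurableSet E) :
    volume (dil c d ⁻¹' E) = ENNReal.ofReal ((c * d)⁻¹) * volume E := by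
  rw [← Measure.map_apply (measurable_dil c d) hE, map_dil hc hd]; simp

theorem scaled_est (s r A : ℝ) (hs1 : 1 ≤ s) (hs2 : s ≤ 2) (hrs : max r 1 ≤ 2 * s)
    (hBH : BH s r A) :
    ∃ C : ℝ≥0∞, C ≠ ∞ ∧ ∀ (W : Set (ℝ × ℝ)), MeasurableSet W → volume W ≠ ∞ →
      ∀ (c₁ c₂ : ℝ), 0 < c₁ → 0 < c₂ → ∀ (M₁ M₂ : Finset ℤ)
      (d e : ℤ), 2 ≤ |d| → |d| ≤ 5 → 2 ≤ |e| → |e| ≤ 5 → ∀ μ : ℝ≥0∞,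
      (∀ m n, volume (W ∩ stile c₁ c₂ m n) ≤ μ) →
      eLpNorm (fun p => ∑ m ∈ M₁, ∑ n ∈ M₂, extOp (chi (W ∩ stile c₁ c₂ m n)) p *
        extOp (chi (W ∩ stile c₁ c₂ (m + d) (n + e))) p) (ENNReal.ofReal s) volume ≤
      C * (ENNReal.ofReal (c₁ * c₂) ^ (2 - 2 / s - 2 / max r 1) *
        μ ^ (2 / max r 1 - 1 / s) * volume W ^ (1 / s)) := by
  obtain ⟨C, hC, hO⟩ := unit_est s r A hs1 hs2 hrs hBH
  have hs0 : 0 < s := by linarith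
  have hR : 0 < max r 1 := lt_max_of_lt_right one_pos
  obtain ⟨R, hRd⟩ : ∃ R, R = max r 1 := ⟨_, rfl⟩
  rw [← hRd] at hR hrs hO ⊢
  refine ⟨C ^ (1 / s), by finiteness, ?_⟩
  intro W hW hWf c₁ c₂ hc₁ hc₂ M₁ M₂ d e hd1 hd2 he1 he2 μ hμ
  have hu := hO (dil c₁ c₂ ⁻¹' W) (measurable_dil _ _ hW) M₁ M₂ d e hd1 hd2 he1 he2
    (ENNReal.ofReal ((c₁ * c₂)⁻¹) * μ) (by
      intro m n
      rw [← dil_stile hc₁ hc₂, ← preimage_inter, volume_dil hc₁ hc₂ (hW.inter (measurableSet_stile _ _ _ _))]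
      gcongr
      exact hμ m n)
  obtain ⟨G, hG⟩ : ∃ G : ℝ × ℝ × ℝ → ℂ, G = fun p => ∑ m ∈ M₁, ∑ n ∈ M₂, 
    extOp (chi (dil c₁ c₂ ⁻¹' W ∩ utile m n)) p *
        extOp (chi (dil c₁ c₂ ⁻¹' W ∩ utile (m + d) (n + e))) p := ⟨_, rfl⟩
  have hfun : (fun p => ∑ m ∈ M₁, ∑ n ∈ M₂, extOp (chi (W ∩ stile c₁ c₂ m n)) p *
        extOp (chi (W ∩ stile c₁ c₂ (m + d) (n + e))) p) = 
        fun p => ((c₁ * c₂ : ℝ) : ℂ) ^ 2 * G (dil3 c₁ c₂ p) := by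
    funext p
    rw [hG]
    simp only [Finset.mul_sum]
    refine Finset.sum_congr rfl fun m _ => Finset.sum_congr rfl fun n _ => ?_
    rw [extOp_dil hc₁ hc₂ (hW.inter (measurableSet_stile _ _ _ _)),
      extOp_dil hc₁ hc₂ (hW.inter (measurableSet_stile _ _ (m + d) _)), preimage_inter, preimage_inter,
      dil_stile hc₁ hc₂, dil_stile hc₁ hc₂]
    ring
  have hGc : Continuous G := by
    rw [hG]
    refine continuous_finsetSum _ fun m _ => continuous_finsetSum _ fun n _ => ?_
    have : ∀ m n, Continuous (extOp (chi (dil c₁ c₂ ⁻¹' W ∩ utile m n))) := fun m n => by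
      apply extOp_continuous
      apply chi_integrable ((measurable_dil _ _ hW).inter (measurableSet_utile _ _))
      refine ((measure_mono inter_subset_left).trans_lt ?_).ne
      rw [volume_dil hc₁ hc₂ hW]
      exact ENNReal.mul_lt_top ENNReal.ofReal_lt_top hWf.lt_top
    exact (this _ _).mul (this _ _)
  have hd3 : Measurable (dil3 c₁ c₂) := by unfold dil3; fun_prop
  have hcc : 0 < c₁ * c₂ := mul_pos hc₁ hc₂
  obtain ⟨κ, hκ⟩ : ∃ κ, κ = ENNReal.ofReal (c₁ * c₂) := ⟨_, rfl⟩
  have hκ0 : κ ≠ 0 := by rw [hκ]; simpa using hcc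
  have hκt : κ ≠ ∞ := by rw [hκ]; simp
  have hκi : ENNReal.ofReal ((c₁ * c₂)⁻¹) = κ ^ (-1 : ℝ) := by
    rw [hκ, ENNReal.ofReal_inv_of_pos hcc, ENNReal.rpow_neg_one]
  rw [hfun, eLpNorm_eq_lintegral_rpow_enorm_toReal (by simpa using hs0) ENNReal.ofReal_ne_top,
      ENNReal.toReal_ofReal hs0.le]
  have hme : Measurable (fun p => ‖G p‖ₑ ^ s) := by
    have := hGc.measurable
    fun_prop
  have h4 : ∫⁻ p, ‖((c₁ * c₂ : ℝ) : ℂ) ^ 2 * G (dil3 c₁ c₂ p)‖ₑ ^ s =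
      κ ^ (2 * s - 2) * ∫⁻ p, ‖G p‖ₑ ^ s := by
    have h5 : ∀ p, ‖((c₁ * c₂ : ℝ) : ℂ) ^ 2 * G (dil3 c₁ c₂ p)‖ₑ ^ s = κ ^ (2 * s) * ‖G (dil3 c₁ c₂ p)‖ₑ ^ s := by
      intro p
      have : ‖((c₁ * c₂ : ℝ) : ℂ)‖ₑ = κ := by
        rw [← ofReal_norm, Complex.norm_real, Real.norm_of_nonneg hcc.le, hκ]
      rw [enorm_mul, enorm_pow, this, ENNReal.mul_rpow_of_nonneg _ _ hs0.le, ← ENNReal.rpow_natCast,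
        ← ENNReal.rpow_mul]
      simp
    simp_rw [h5]
    rw [lintegral_const_mul (f := fun p => ‖G (dil3 c₁ c₂ p)‖ₑ ^ s) _ (hme.comp hd3), ← lintegral_map (f := fun p => ‖G p‖ₑ ^ s) hme hd3, map_dil3 hc₁ hc₂,
      lintegral_smul_measure, hκi, ← ENNReal.rpow_add _ _ hκ0 hκt, smul_eq_mul, ← mul_assoc,
      ← ENNReal.rpow_add _ _ hκ0 hκt]
    congr 2
    ring
  rw [h4]
  have hu' : ∫⁻ p, ‖G p‖ₑ ^ s ≤ C * (κ ^ (-(2 * s / R)) * (μ ^ (2 * s / R - 1) * volume W)) := by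
    rw [hG]
    refine hu.trans (le_of_eq ?_)
    have hq : 0 ≤ 2 * s / R - 1 := by
      rw [sub_nonneg, le_div_iff₀ hR, one_mul]; exact hrs
    rw [volume_dil hc₁ hc₂ hW, ENNReal.mul_rpow_of_nonneg _ _ hq, hκi, ← ENNReal.rpow_mul]
    have : κ ^ (-(2 * s / R)) = κ ^ (-1 * (2 * s / R - 1)) * κ ^ (-1 : ℝ) := by
      rw [← ENNReal.rpow_add _ _ hκ0 hκt]
      congr 1
      ring
    rw [this]
    ring
  have h1s : 0 ≤ 1 / s := by positivity
  calc _ ≤ (κ ^ (2 * s - 2) * (C * (κ ^ (-(2 * s / R)) * (μ ^ (2 * s / R - 1) * volume W)))) ^ (1 / s) := by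
        gcongr
    _ = (C * (κ ^ (2 * s - 2 - 2 * s / R) * (μ ^ (2 * s / R - 1) * volume W))) ^ (1 / s) := by
        rw [sub_eq_add_neg _ (2 * s / R), ENNReal.rpow_add _ _ hκ0 hκt]
        congr 1
        ring
    _ = _ := by
        rw [ENNReal.mul_rpow_of_nonneg _ _ h1s, ENNReal.mul_rpow_of_nonneg _ _ h1s,
          ENNReal.mul_rpow_of_nonneg _ _ h1s, ← ENNReal.rpow_mul, ← ENNReal.rpow_mul, ← hκ,
          ← mul_assoc (κ ^ _)]
        congr 4
        · field_simp
        · field_simp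


/-- Dyadic floor. -/
noncomputable def fl (j : ℕ) (x : ℝ) : ℤ := ⌊(2 : ℝ) ^ j * x⌋

theorem fl_succ (j : ℕ) (x : ℝ) : fl j x = fl (j + 1) x / 2 := by
  unfold fl
  have h : (2 : ℝ) ^ j * x = (2 : ℝ) ^ (j + 1) * x / 2 := by ring
  rw [h]
  have := Int.floor_div_natCast ((2 : ℝ) ^ (j + 1) * x) 2
  simpa using this

theorem measurable_fl (j : ℕ) : Measurable (fl j) :=
  Int.measurable_floor.comp (measurable_const_mul _)

/-- Indicator of closeness at scale `j`. -/
noncomputable def near (j : ℕ) (x y : ℝ) : ℂ := if |fl j x - fl j y| ≤ 1 then 1 else 0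

/-- offsets -/
def DD : Finset ℤ := {-3, -2, 2, 3}

/-- admissible positions -/
noncomputable def MM (j : ℕ) (d : ℤ) : Finset ℤ :=
  (Finset.Icc 0 (2 ^ (j + 1))).filter fun m => |m / 2 - (m + d) / 2| ≤ 1

/-- Indicator that `x, y` are in prescribed dyadic intervals. -/
noncomputable def pos (j : ℕ) (d m : ℤ) (x y : ℝ) : ℂ :=
  if fl (j + 1) x = m ∧ fl (j + 1) y = m + d then 1 else 0

theorem fl_bd {j : ℕ} {x : ℝ} (hx : x ∈ Icc (0 : ℝ) 1) : 0 ≤ fl j x ∧ fl j x ≤ 2 ^ j := by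
  unfold fl
  constructor
  · exact Int.floor_nonneg.mpr (mul_nonneg (by positivity) hx.1)
  · have : (⌊(2 : ℝ) ^ j * x⌋ : ℝ) ≤ ((2 ^ j : ℤ) : ℝ) := by
      refine (Int.floor_le _).trans ?_
      push_cast
      exact mul_le_of_le_one_right (by positivity) hx.2
    exact_mod_cast this

theorem whit1 {j : ℕ} {x y : ℝ} (hx : x ∈ Icc (0 : ℝ) 1) :
    near j x y - near (j + 1) x y = ∑ d ∈ DD, ∑ m ∈ MM j d, pos j d m x y := by
  have hb := fl_bd (j := j + 1) hx
  unfold near pos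
  rw [fl_succ j x, fl_succ j y]
  generalize fl (j + 1) x = a at *
  generalize fl (j + 1) y = b at *
  have h1 : ∀ d, ∑ m ∈ MM j d, (if a = m ∧ b = m + d then (1 : ℂ) else 0) =
      if |a / 2 - b / 2| ≤ 1 ∧ b = a + d then 1 else 0 := by
    intro d
    simp_rw [ite_and]
    rw [Finset.sum_ite_eq]
    simp only [MM, Finset.mem_filter, Finset.mem_Icc, hb, true_and]
    by_cases h : b = a + d <;> simp [h]
  simp_rw [h1]
  simp only [DD]
  rw [Finset.sum_insert (by decide), Finset.sum_insert (by decide), Finset.sum_insert (by decide),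
    Finset.sum_singleton]
  simp only [abs_le]
  split_ifs <;> first | omega | norm_num

theorem near_norm (j : ℕ) (x y : ℝ) : near j x y = 0 ∨ near j x y = 1 := by
  unfold near; split_ifs <;> simp

theorem near_zero {x y : ℝ} (hx : x ∈ Icc (0 : ℝ) 1) (hy : y ∈ Icc (0 : ℝ) 1) : near 0 x y = 1 := by
  have := fl_bd (j := 0) hx
  have := fl_bd (j := 0) hy
  unfold near
  rw [if_pos]
  rw [abs_le]
  constructor <;> norm_num at * <;> omega

theorem near_tendsto {x y : ℝ} (hxy : x ≠ y) : ∀ᶠ N in Filter.atTop, near N x y = 0 := by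
  have h0 : 0 < |x - y| := abs_pos.mpr (sub_ne_zero.mpr hxy)
  have ht := (tendsto_pow_atTop_atTop_of_one_lt (r := (2 : ℝ)) (by norm_num)).eventually_gt_atTop
    (2 / |x - y|)
  filter_upwards [ht] with N hN
  unfold near
  rw [if_neg]
  intro h
  rw [div_lt_iff₀ h0] at hN
  have h1 : |(2 : ℝ) ^ N * x - 2 ^ N * y| > 2 := by
    rw [← mul_sub, abs_mul, abs_of_pos (by positivity)]; exact hN
  have h2 : |((fl N x - fl N y : ℤ) : ℝ)| ≤ 1 := by exact_mod_cast h
  push_cast at h2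
  unfold fl at h2
  have a1 := Int.floor_le ((2 : ℝ) ^ N * x)
  have a2 := Int.lt_floor_add_one ((2 : ℝ) ^ N * x)
  have a3 := Int.floor_le ((2 : ℝ) ^ N * y)
  have a4 := Int.lt_floor_add_one ((2 : ℝ) ^ N * y)
  rw [abs_le] at h2
  have : |(2 : ℝ) ^ N * x - 2 ^ N * y| ≤ 2 := by
    rw [abs_le]; constructor <;> linarith
  linarith

theorem whit_sum {N : ℕ} {x y : ℝ} (hx : x ∈ Icc (0 : ℝ) 1) (hy : y ∈ Icc (0 : ℝ) 1) :
    ∑ j ∈ Finset.range N, ∑ d ∈ DD, ∑ m ∈ MM j d, pos j d m x y = 1 - near N x y := by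
  simp_rw [← whit1 hx]
  rw [Finset.sum_range_sub', near_zero hx hy]

/-- length of the level `j + 1` dyadic intervals -/
noncomputable def cc (j : ℕ) : ℝ := ((2 : ℝ) ^ (j + 1))⁻¹

theorem chi_mul_pos (W : Set (ℝ × ℝ)) (j k : ℕ) (d e m n : ℤ) (ξ ζ : ℝ × ℝ) :
    chi (W ∩ stile (cc j) (cc k) m n) ξ * chi (W ∩ stile (cc j) (cc k) (m + d) (n + e)) ζ =
    chi W ξ * chi W ζ * (pos j d m ξ.1 ζ.1 * pos k e n ξ.2 ζ.2) := by
  classical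
  have hc : ∀ (E : Set (ℝ × ℝ)) (x : ℝ × ℝ), chi E x = if x ∈ E then 1 else 0 := fun E x => by
    rw [chi, indicator_apply]
  have hst : ∀ (x : ℝ × ℝ) (m n : ℤ), x ∈ stile (cc j) (cc k) m n ↔
      fl (j + 1) x.1 = m ∧ fl (k + 1) x.2 = n := fun x m n => by
    simp [stile, cc, fl]
  simp only [hc, pos, mem_inter_iff, hst]
  split_ifs <;> first | (exfalso; tauto) | simp

/-- The `(j,k)` bilinear piece. -/
noncomputable def Bil (W : Set (ℝ × ℝ)) (j k : ℕ) (p : ℝ × ℝ × ℝ) : ℂ :=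
  ∑ d ∈ DD, ∑ e ∈ DD, ∑ m ∈ MM j d, ∑ n ∈ MM k e,
    extOp (chi (W ∩ stile (cc j) (cc k) m n)) p *
      extOp (chi (W ∩ stile (cc j) (cc k) (m + d) (n + e))) p

/-- phase -/
noncomputable def ph (p : ℝ × ℝ × ℝ) (ξ : ℝ × ℝ) : ℂ :=
  Complex.exp (Complex.I * (p.1 * ξ.1 * ξ.2 + p.2.1 * ξ.1 + p.2.2 * ξ.2 : ℝ))

theorem Bil_eq {W : Set (ℝ × ℝ)} (hW : MeasurableSet W) (hf : volume W ≠ ∞) (j k : ℕ) (p : ℝ × ℝ × ℝ) :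
    Integrable (fun z : (ℝ × ℝ) × (ℝ × ℝ) => (ph p z.1 * chi W z.1) * (ph p z.2 * chi W z.2) *
      ((∑ d ∈ DD, ∑ m ∈ MM j d, pos j d m z.1.1 z.2.1) *
        (∑ d ∈ DD, ∑ m ∈ MM k d, pos k d m z.1.2 z.2.2))) ∧
    Bil W j k p = ∫ z : (ℝ × ℝ) × (ℝ × ℝ), (ph p z.1 * chi W z.1) * (ph p z.2 * chi W z.2) *
      ((∑ d ∈ DD, ∑ m ∈ MM j d, pos j d m z.1.1 z.2.1) *
        (∑ d ∈ DD, ∑ m ∈ MM k d, pos k d m z.1.2 z.2.2)) := by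
  have hi : ∀ m n, Integrable (chi (W ∩ stile (cc j) (cc k) m n)) := fun m n =>
    chi_integrable (hW.inter (measurableSet_stile _ _ _ _))
      ((measure_mono inter_subset_left).trans_lt hf.lt_top).ne
  have hIntg : ∀ m n d e, Integrable (fun z : (ℝ × ℝ) × (ℝ × ℝ) =>
      (ph p z.1 * chi (W ∩ stile (cc j) (cc k) m n) z.1) *
      (ph p z.2 * chi (W ∩ stile (cc j) (cc k) (m + d) (n + e)) z.2)) := fun m n d e =>
    (extOp_integrand_integrable (hi m n) p).mul_prod (extOp_integrand_integrable (hi (m + d) (n + e)) p)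
  have hfun : (fun z : (ℝ × ℝ) × (ℝ × ℝ) => (ph p z.1 * chi W z.1) * (ph p z.2 * chi W z.2) *
      ((∑ d ∈ DD, ∑ m ∈ MM j d, pos j d m z.1.1 z.2.1) *
        (∑ d ∈ DD, ∑ m ∈ MM k d, pos k d m z.1.2 z.2.2))) =
      fun z => ∑ d ∈ DD, ∑ e ∈ DD, ∑ m ∈ MM j d, ∑ n ∈ MM k e, 
        (ph p z.1 * chi (W ∩ stile (cc j) (cc k) m n) z.1) *
        (ph p z.2 * chi (W ∩ stile (cc j) (cc k) (m + d) (n + e)) z.2) := by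
    funext z
    rw [Finset.sum_mul_sum, Finset.mul_sum]
    refine Finset.sum_congr rfl fun d _ => ?_
    rw [Finset.mul_sum]
    refine Finset.sum_congr rfl fun e _ => ?_
    rw [Finset.sum_mul_sum, Finset.mul_sum]
    refine Finset.sum_congr rfl fun m _ => ?_
    rw [Finset.mul_sum]
    refine Finset.sum_congr rfl fun n _ => ?_
    have := chi_mul_pos W j k d e m n z.1 z.2
    linear_combination (-(ph p z.1 * ph p z.2)) * this
  rw [hfun]
  have i1 := fun d e m => integrable_finsetSum (MM k e) fun n _ => hIntg m n d e
  have i2 := fun d e => integrable_finsetSum (MM j d) fun m _ => i1 d e m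
  have i3 := fun d => integrable_finsetSum DD fun e _ => i2 d e
  have i4 := integrable_finsetSum DD fun d _ => i3 d
  refine ⟨i4, ?_⟩
  rw [integral_finsetSum _ fun d _ => i3 d]
  refine Finset.sum_congr rfl fun d _ => ?_
  rw [integral_finsetSum _ fun e _ => i2 d e]
  refine Finset.sum_congr rfl fun e _ => ?_
  rw [integral_finsetSum _ fun m _ => i1 d e m]
  refine Finset.sum_congr rfl fun m _ => ?_
  rw [integral_finsetSum _ fun n _ => hIntg m n d e]
  refine Finset.sum_congr rfl fun n _ => ?_
  exact extOp_mul p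

theorem ae_ne_fst : ∀ᵐ z : (ℝ × ℝ) × (ℝ × ℝ), z.1.1 ≠ z.2.1 := by
  have hm : MeasurableSet {z : (ℝ × ℝ) × (ℝ × ℝ) | z.1.1 ≠ z.2.1} :=
    (measurableSet_eq_fun (by fun_prop) (by fun_prop)).compl
  rw [Measure.volume_eq_prod, Measure.ae_prod_iff_ae_ae hm]
  refine Filter.Eventually.of_forall fun x => ?_
  rw [ae_iff]
  have : {a : ℝ × ℝ | ¬ x.1 ≠ a.1} = {x.1} ×ˢ univ := by
    ext a; simp [eq_comm]
  rw [this, Measure.volume_eq_prod, Measure.prod_prod]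
  simp

theorem ae_ne_snd : ∀ᵐ z : (ℝ × ℝ) × (ℝ × ℝ), z.1.2 ≠ z.2.2 := by
  have hm : MeasurableSet {z : (ℝ × ℝ) × (ℝ × ℝ) | z.1.2 ≠ z.2.2} :=
    (measurableSet_eq_fun (by fun_prop) (by fun_prop)).compl
  rw [Measure.volume_eq_prod, Measure.ae_prod_iff_ae_ae hm]
  refine Filter.Eventually.of_forall fun x => ?_
  rw [ae_iff]
  have : {a : ℝ × ℝ | ¬ x.2 ≠ a.2} = univ ×ˢ {x.2} := by
    ext a; simp [eq_comm]
  rw [this, Measure.volume_eq_prod, Measure.prod_prod]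
  simp

theorem whitney_tendsto {W : Set (ℝ × ℝ)} (hW : MeasurableSet W) (hW1 : W ⊆ Icc 0 1 ×ˢ Icc 0 1)
    (p : ℝ × ℝ × ℝ) :
    Filter.Tendsto (fun N => ∑ j ∈ Finset.range N, ∑ k ∈ Finset.range N, Bil W j k p) Filter.atTop
      (nhds (extOp (chi W) p * extOp (chi W) p)) := by
  have hf : volume W ≠ ∞ := by
    refine ((measure_mono hW1).trans_lt ?_).ne
    rw [Measure.volume_eq_prod, Measure.prod_prod]; simp
  have hi := chi_integrable hW hf
  have hIntg : Integrable (fun z : (ℝ × ℝ) × (ℝ × ℝ) =>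
      (ph p z.1 * chi W z.1) * (ph p z.2 * chi W z.2)) :=
    (extOp_integrand_integrable hi p).mul_prod (extOp_integrand_integrable hi p)
  have hfun : (fun N => ∑ j ∈ Finset.range N, ∑ k ∈ Finset.range N, Bil W j k p) =
      fun N => ∫ z : (ℝ × ℝ) × (ℝ × ℝ), (ph p z.1 * chi W z.1) * (ph p z.2 * chi W z.2) *
        ((∑ j ∈ Finset.range N, ∑ d ∈ DD, ∑ m ∈ MM j d, pos j d m z.1.1 z.2.1) *
        (∑ k ∈ Finset.range N, ∑ d ∈ DD, ∑ m ∈ MM k d, pos k d m z.1.2 z.2.2)) := by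
    funext N
    simp_rw [Finset.sum_mul_sum, Finset.mul_sum]
    simp_rw [(Bil_eq hW hf _ _ p).2]
    have hBi := fun j k => (Bil_eq hW hf j k p).1
    simp_rw [Finset.sum_mul_sum, Finset.mul_sum] at hBi
    rw [integral_finsetSum _ fun j _ => integrable_finsetSum _ fun k _ => hBi j k]
    refine Finset.sum_congr rfl fun j _ => ?_
    rw [integral_finsetSum _ fun k _ => hBi j k]
    simp_rw [Finset.sum_mul_sum, Finset.mul_sum]
  rw [hfun, extOp_mul]
  have hptw : ∀ N (z : (ℝ × ℝ) × (ℝ × ℝ)), (ph p z.1 * chi W z.1) * (ph p z.2 * chi W z.2) *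
        ((∑ j ∈ Finset.range N, ∑ d ∈ DD, ∑ m ∈ MM j d, pos j d m z.1.1 z.2.1) *
        (∑ k ∈ Finset.range N, ∑ d ∈ DD, ∑ m ∈ MM k d, pos k d m z.1.2 z.2.2)) =
        (ph p z.1 * chi W z.1) * (ph p z.2 * chi W z.2) *
        ((1 - near N z.1.1 z.2.1) * (1 - near N z.1.2 z.2.2)) := by
    intro N z
    by_cases h1 : z.1 ∈ W
    · by_cases h2 : z.2 ∈ W
      · rw [whit_sum (hW1 h1).1 (hW1 h2).1, whit_sum (hW1 h1).2 (hW1 h2).2]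
      · simp [chi, h2]
    · simp [chi, h1]
  simp_rw [hptw]
  have hnm : ∀ N, Measurable (fun q : ℝ × ℝ => near N q.1 q.2) := by
    intro N
    unfold near
    refine Measurable.ite ?_ measurable_const measurable_const
    have h1 : Measurable fun q : ℝ × ℝ => |fl N q.1 - fl N q.2| := by
      have ha : Measurable fun q : ℝ × ℝ => fl N q.1 := (measurable_fl N).comp measurable_fst
      have hb : Measurable fun q : ℝ × ℝ => fl N q.2 := (measurable_fl N).comp measurable_snd
      exact (measurable_of_countable (fun q : ℤ × ℤ => |q.1 - q.2|)).comp (ha.prodMk hb)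
    exact h1 (measurableSet_Iic (a := (1 : ℤ)))
  refine tendsto_integral_of_dominated_convergence
    (fun z => ‖(ph p z.1 * chi W z.1) * (ph p z.2 * chi W z.2)‖) (fun N => ?_) hIntg.norm ?_ ?_
  · refine hIntg.1.mul (Measurable.aestronglyMeasurable ?_)
    have h1 := (hnm N).comp (f := fun z : (ℝ × ℝ) × (ℝ × ℝ) => (z.1.1, z.2.1)) (by fun_prop)
    have h2 := (hnm N).comp (f := fun z : (ℝ × ℝ) × (ℝ × ℝ) => (z.1.2, z.2.2)) (by fun_prop)
    exact (measurable_const.sub h1).mul (measurable_const.sub h2)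
  · intro N
    refine Filter.Eventually.of_forall fun z => ?_
    rw [norm_mul _ (_ * _)]
    refine mul_le_of_le_one_right (norm_nonneg _) ?_
    rcases near_norm N z.1.1 z.2.1 with h | h <;> rcases near_norm N z.1.2 z.2.2 with h' | h' <;>
      simp [h, h']
  · filter_upwards [ae_ne_fst, ae_ne_snd] with z h1 h2
    refine tendsto_const_nhds.congr' ?_
    filter_upwards [near_tendsto h1, near_tendsto h2] with N a1 a2
    rw [a1, a2]
    simp [ph]


theorem stile_cont {W : Set (ℝ × ℝ)} (hW : MeasurableSet W) (hf : volume W ≠ ∞) (c d : ℝ) (m n : ℤ) :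
    Continuous (extOp (chi (W ∩ stile c d m n))) :=
  extOp_continuous (chi_integrable (hW.inter (measurableSet_stile _ _ _ _))
      ((measure_mono inter_subset_left).trans_lt hf.lt_top).ne)

theorem eLpNorm_sum_le' {ι : Type*} {f : ι → ℝ × ℝ × ℝ → ℂ} {S : Finset ι} {p : ℝ≥0∞} (hp : 1 ≤ p)
    (hf : ∀ i, Continuous (f i)) :
    eLpNorm (fun x => ∑ i ∈ S, f i x) p volume ≤ ∑ i ∈ S, eLpNorm (f i) p volume := by
  have := eLpNorm_sum_le (f := f) (s := S) (μ := volume) (fun i _ => (hf i).aestronglyMeasurable) hp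
  rwa [Finset.sum_fn] at this

theorem mem_DD {d : ℤ} (h : d ∈ DD) : 2 ≤ |d| ∧ |d| ≤ 5 := by
  simp only [DD, Finset.mem_insert, Finset.mem_singleton] at h
  rcases h with rfl | rfl | rfl | rfl <;> norm_num

theorem sq_eLpNorm {g : ℝ × ℝ × ℝ → ℂ} {s : ℝ} (hs : 0 < s) :
    eLpNorm (fun p => g p * g p) (ENNReal.ofReal s) volume =
      eLpNorm g (ENNReal.ofReal (2 * s)) volume ^ 2 := by
  rw [eLpNorm_eq_lintegral_rpow_enorm_toReal (by simpa using hs) ENNReal.ofReal_ne_top,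
    eLpNorm_eq_lintegral_rpow_enorm_toReal (by simpa using hs) ENNReal.ofReal_ne_top,
    ENNReal.toReal_ofReal hs.le, ENNReal.toReal_ofReal (by positivity), ← ENNReal.rpow_natCast,
    ← ENNReal.rpow_mul]
  congr 1
  · refine lintegral_congr fun p => ?_
    rw [enorm_mul, ENNReal.mul_rpow_of_nonneg _ _ hs.le, ← ENNReal.rpow_add_of_nonneg _ _ hs.le hs.le,
      two_mul]
  · push_cast; field_simp

theorem sum_bound (s r A : ℝ) (hs1 : 1 ≤ s) (hs2 : s ≤ 2) (hrs : max r 1 ≤ 2 * s)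
    (hBH : BH s r A) :
    ∃ C : ℝ≥0∞, C ≠ ∞ ∧ ∀ (W : Set (ℝ × ℝ)), MeasurableSet W → W ⊆ Icc 0 1 ×ˢ Icc 0 1 →
      ∀ (μ : ℕ → ℕ → ℝ≥0∞), (∀ j k m n, volume (W ∩ stile (cc j) (cc k) m n) ≤ μ j k) →
      ∀ B : ℝ≥0∞, (∀ N, ∑ j ∈ Finset.range N, ∑ k ∈ Finset.range N,
        ENNReal.ofReal (cc j * cc k) ^ (2 - 2 / s - 2 / max r 1) *
        μ j k ^ (2 / max r 1 - 1 / s) ≤ B) →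
      eLpNorm (extOp (chi W)) (ENNReal.ofReal (2 * s)) volume ^ 2 ≤ C * (B * volume W ^ (1 / s)) := by
  obtain ⟨C, hC, hO⟩ := scaled_est s r A hs1 hs2 hrs hBH
  have hs0 : 0 < s := by linarith
  refine ⟨16 * C, by finiteness, ?_⟩
  intro W hW hW1 μ hμ B hB
  have hf : volume W ≠ ∞ := by
    refine ((measure_mono hW1).trans_lt ?_).ne
    rw [Measure.volume_eq_prod, Measure.prod_prod]; simp
  have hcont := stile_cont hW hf
  have hp : 1 ≤ ENNReal.ofReal s := by simpa using hs1
  have hc0 : ∀ j, 0 < cc j := fun j => by unfold cc; positivity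
  have hBc : ∀ j k, Continuous (Bil W j k) := fun j k => by
    unfold Bil
    exact continuous_finsetSum _ fun d _ => continuous_finsetSum _ fun e _ =>
      continuous_finsetSum _ fun m _ => continuous_finsetSum _ fun n _ => (hcont _ _ _ _).mul (hcont _ _ _ _)
  have hBil : ∀ j k, eLpNorm (Bil W j k) (ENNReal.ofReal s) volume ≤ 16 * C *
      ((ENNReal.ofReal (cc j * cc k) ^ (2 - 2 / s - 2 / max r 1) *
        μ j k ^ (2 / max r 1 - 1 / s)) * volume W ^ (1 / s)) := by
    intro j k
    have hin : ∀ d e, Continuous (fun p => ∑ m ∈ MM j d, ∑ n ∈ MM k e,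
      extOp (chi (W ∩ stile (cc j) (cc k) m n)) p *
      extOp (chi (W ∩ stile (cc j) (cc k) (m + d) (n + e))) p) := fun d e =>
      continuous_finsetSum _ fun m _ => continuous_finsetSum _ fun n _ => (hcont _ _ _ _).mul (hcont _ _ _ _)
    unfold Bil
    refine (eLpNorm_sum_le' hp fun d => continuous_finsetSum _ fun e _ => hin d e).trans ?_
    calc _ ≤ ∑ d ∈ DD, ∑ e ∈ DD, C * ((ENNReal.ofReal (cc j * cc k) ^ (2 - 2 / s - 2 / max r 1) *
        μ j k ^ (2 / max r 1 - 1 / s)) * volume W ^ (1 / s)) := by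
          refine Finset.sum_le_sum fun d hd => ?_
          refine (eLpNorm_sum_le' hp fun e => hin d e).trans ?_
          refine Finset.sum_le_sum fun e he => ?_
          exact hO W hW hf (cc j) (cc k) (hc0 j) (hc0 k) _ _ d e (mem_DD hd).1 (mem_DD hd).2
            (mem_DD he).1 (mem_DD he).2 _ (hμ j k)
      _ = _ := by
          have : (DD.card : ℝ≥0∞) = 4 := by norm_num [DD]
          rw [Finset.sum_const, Finset.sum_const, nsmul_eq_mul, nsmul_eq_mul, this]
          ring
  rw [← sq_eLpNorm hs0]
  have hlim := Lp.eLpNorm_lim_le_liminf_eLpNorm (μ := (volume : Measure (ℝ × ℝ × ℝ))) (p := ENNReal.ofReal s)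
    (f := fun N p => ∑ j ∈ Finset.range N, ∑ k ∈ Finset.range N, Bil W j k p)
    (fun N => (continuous_finsetSum _ fun j _ => continuous_finsetSum _ fun k _ => hBc j k).aestronglyMeasurable)
    (fun p => extOp (chi W) p * extOp (chi W) p)
    (Filter.Eventually.of_forall fun p => whitney_tendsto hW hW1 p)
  refine hlim.trans ?_
  have hN : ∀ N, eLpNorm (fun p => ∑ j ∈ Finset.range N, ∑ k ∈ Finset.range N, Bil W j k p)
      (ENNReal.ofReal s) volume ≤ 16 * C * (B * volume W ^ (1 / s)) := by
    intro N
    refine (eLpNorm_sum_le' hp fun j => continuous_finsetSum _ fun k _ => hBc j k).trans ?_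
    calc _ ≤ ∑ j ∈ Finset.range N, ∑ k ∈ Finset.range N, 16 * C *
      ((ENNReal.ofReal (cc j * cc k) ^ (2 - 2 / s - 2 / max r 1) *
        μ j k ^ (2 / max r 1 - 1 / s)) * volume W ^ (1 / s)) := by
          refine Finset.sum_le_sum fun j _ => ?_
          refine (eLpNorm_sum_le' hp fun k => hBc j k).trans ?_
          exact Finset.sum_le_sum fun k _ => hBil j k
      _ = 16 * C * ((∑ j ∈ Finset.range N, ∑ k ∈ Finset.range N,
        ENNReal.ofReal (cc j * cc k) ^ (2 - 2 / s - 2 / max r 1) *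
        μ j k ^ (2 / max r 1 - 1 / s)) * volume W ^ (1 / s)) := by
          simp_rw [← Finset.mul_sum, ← Finset.sum_mul]
      _ ≤ _ := by
          gcongr
          exact hB N
  exact Filter.liminf_le_of_le (by isBoundedDefault) fun b hb => by
    obtain ⟨N, hN'⟩ := hb.exists
    exact hN'.trans (hN N)


theorem volume_floor_le {c : ℝ} (hc : 0 < c) (m : ℤ) :
    volume {x : ℝ | ⌊c⁻¹ * x⌋ = m} ≤ ENNReal.ofReal c := by
  have h : {x : ℝ | ⌊c⁻¹ * x⌋ = m} ⊆ Icc (c * m) (c * m + c) := by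
    intro x hx
    have hx' : ⌊c⁻¹ * x⌋ = m := hx
    rw [Int.floor_eq_iff] at hx'
    have e : c * (c⁻¹ * x) = x := by field_simp
    constructor
    · rw [← e]; gcongr; exact hx'.1
    · rw [← e]
      have := mul_le_mul_of_nonneg_left hx'.2.le hc.le
      linarith
  refine (measure_mono h).trans ?_
  rw [Real.volume_Icc]
  simp

theorem tile_bound1 {Ω W : Set (ℝ × ℝ)} (hW : MeasurableSet W) (hWΩ : W ⊆ Ω) {a b : ℝ≥0∞}
    (hv : ∀ x, (vFiber Ω x).Nonempty → volume (vFiber Ω x) ≤ b) (hp : volume (Prod.fst '' Ω) ≤ a)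
    {c d : ℝ} (hc : 0 < c) (hd : 0 < d) (m n : ℤ) :
    volume (W ∩ stile c d m n) ≤ min a (ENNReal.ofReal c) * min b (ENNReal.ofReal d) := by
  have hE : MeasurableSet (W ∩ stile c d m n) := hW.inter (measurableSet_stile _ _ _ _)
  rw [Measure.volume_eq_prod, Measure.prod_apply hE]
  have hv' : ∀ x, volume (vFiber Ω x) ≤ b := by
    intro x
    by_cases h : (vFiber Ω x).Nonempty
    · exact hv x h
    · rw [not_nonempty_iff_eq_empty.mp h]; simp
  have hm2 : MeasurableSet {x : ℝ | ⌊c⁻¹ * x⌋ = m} :=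
    (Int.measurable_floor.comp (measurable_const_mul c⁻¹)) (measurableSet_singleton m)
  obtain ⟨T, hT⟩ : ∃ T, T = toMeasurable volume (Prod.fst '' Ω) ∩ {x : ℝ | ⌊c⁻¹ * x⌋ = m} := ⟨_, rfl⟩
  have hTm : MeasurableSet T := by rw [hT]; exact (measurableSet_toMeasurable _ _).inter hm2
  have hTv : volume T ≤ min a (ENNReal.ofReal c) := by
    rw [hT]
    refine le_min ((measure_mono inter_subset_left).trans ?_) ((measure_mono inter_subset_right).trans
      (volume_floor_le hc m))
    rw [measure_toMeasurable]; exact hp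
  calc _ ≤ ∫⁻ x, T.indicator (fun _ => min b (ENNReal.ofReal d)) x := by
        refine lintegral_mono fun x => ?_
        by_cases hx : x ∈ T
        · rw [indicator_of_mem hx]
          refine le_min ((measure_mono ?_).trans (hv' x)) ((measure_mono ?_).trans (volume_floor_le hd n))
          · intro y hy
            exact hWΩ hy.1
          · intro y hy
            exact hy.2.2
        · rw [indicator_of_notMem hx]
          have : (Prod.mk x ⁻¹' (W ∩ stile c d m n)) = ∅ := by
            rw [eq_empty_iff_forall_notMem]
            intro y hy
            apply hx
            rw [hT]
            exact ⟨subset_toMeasurable _ _ ⟨_, hWΩ hy.1, rfl⟩, hy.2.1⟩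
          simp [this]
    _ = min b (ENNReal.ofReal d) * volume T := by rw [lintegral_indicator_const hTm]
    _ ≤ _ := by rw [mul_comm]; gcongr

theorem tile_bound2 {W : Set (ℝ × ℝ)} (hW : MeasurableSet W) {δ : ℝ≥0∞}
    (hh : ∀ y, volume (hFiber W y) ≤ δ)
    {c d : ℝ} (hd : 0 < d) (m n : ℤ) :
    volume (W ∩ stile c d m n) ≤ δ * ENNReal.ofReal d := by
  have hE : MeasurableSet (W ∩ stile c d m n) := hW.inter (measurableSet_stile _ _ _ _)
  rw [Measure.volume_eq_prod, Measure.prod_apply_symm hE]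
  have hm2 : MeasurableSet {x : ℝ | ⌊d⁻¹ * x⌋ = n} :=
    (Int.measurable_floor.comp (measurable_const_mul d⁻¹)) (measurableSet_singleton n)
  calc _ ≤ ∫⁻ y, {x : ℝ | ⌊d⁻¹ * x⌋ = n}.indicator (fun _ => δ) y := by
        refine lintegral_mono fun y => ?_
        by_cases hy : y ∈ {x : ℝ | ⌊d⁻¹ * x⌋ = n}
        · rw [indicator_of_mem hy]
          exact (measure_mono fun x hx => hx.1).trans (hh y)
        · rw [indicator_of_notMem hy]
          have : ((fun x => (x, y)) ⁻¹' (W ∩ stile c d m n)) = ∅ := by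
            rw [eq_empty_iff_forall_notMem]
            intro x hx
            exact hy hx.2.2
          simp [this]
    _ = δ * volume {x : ℝ | ⌊d⁻¹ * x⌋ = n} := by rw [lintegral_indicator_const hm2]
    _ ≤ _ := by gcongr; exact volume_floor_le hd n

theorem vol_lower {Ω : Set (ℝ × ℝ)} (hΩ : MeasurableSet Ω) {a b : ℝ≥0∞}
    (hv : ∀ x, (vFiber Ω x).Nonempty → b ≤ volume (vFiber Ω x)) (hp : a ≤ volume (Prod.fst '' Ω)) :
    b * a ≤ volume Ω := by
  rw [Measure.volume_eq_prod, Measure.prod_apply hΩ]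
  have := mul_meas_ge_le_lintegral (μ := (volume : Measure ℝ)) (measurable_measure_prodMk_left (ν := volume) hΩ) b
  refine le_trans ?_ this
  gcongr
  refine hp.trans (measure_mono ?_)
  rintro _ ⟨ξ, hξ, rfl⟩
  exact hv ξ.1 ⟨ξ.2, hξ⟩

theorem geo_ne_top {a : ℝ} (ha : 0 < a) : ∑' n : ℤ, (2 : ℝ≥0∞) ^ (-(a * |(n : ℝ)|)) ≠ ∞ := by
  have h1 : ∀ n : ℤ, (2 : ℝ≥0∞) ^ (-(a * |(n : ℝ)|)) = ENNReal.ofReal ((2 : ℝ) ^ (-(a * |(n : ℝ)|))) := by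
    intro n
    rw [← ENNReal.ofReal_rpow_of_pos (by norm_num)]; simp
  simp_rw [h1]
  have hg : Summable fun n : ℕ => (2 : ℝ) ^ (-(a * (n : ℝ))) := by
    have : (fun n : ℕ => (2 : ℝ) ^ (-(a * (n : ℝ)))) = fun n : ℕ => ((2 : ℝ) ^ (-a)) ^ n := by
      funext n
      rw [← Real.rpow_natCast, ← Real.rpow_mul (by norm_num)]
      ring_nf
    rw [this]
    exact summable_geometric_of_lt_one (by positivity) (Real.rpow_lt_one_of_one_lt_of_neg (by norm_num) (by linarith))
  have hs : Summable fun n : ℤ => (2 : ℝ) ^ (-(a * |(n : ℝ)|)) := by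
    refine Summable.of_nat_of_neg ?_ ?_
    · simpa using hg
    · simpa using hg
  exact hs.tsum_ofReal_ne_top

theorem geo_sum_le {a : ℝ} (J N : ℕ) : ∑ j ∈ Finset.range N, (2 : ℝ≥0∞) ^ (-(a * |((j : ℝ) + 1) - J|)) ≤
    ∑' n : ℤ, (2 : ℝ≥0∞) ^ (-(a * |(n : ℝ)|)) := by
  refine (ENNReal.sum_le_tsum _).trans ?_
  have hi : Function.Injective (fun j : ℕ => (j : ℤ) + 1 - J) := by
    intro x y h
    simpa using h
  have := ENNReal.tsum_comp_le_tsum_of_injective hi (fun n : ℤ => (2 : ℝ≥0∞) ^ (-(a * |(n : ℝ)|)))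
  push_cast at this
  exact this


theorem two_add (x y : ℝ) : (2 : ℝ≥0∞) ^ (x + y) = 2 ^ x * 2 ^ y :=
  ENNReal.rpow_add _ _ (by norm_num) (by norm_num)

theorem ofReal_cc (j : ℕ) : ENNReal.ofReal (cc j) = (2 : ℝ≥0∞) ^ (-((j : ℝ) + 1)) := by
  unfold cc
  rw [ENNReal.ofReal_inv_of_pos (by positivity), ENNReal.ofReal_pow (by norm_num), ENNReal.rpow_neg]
  congr 1
  rw [← ENNReal.rpow_natCast]
  simp

theorem min_bd (J j : ℕ) : min ((2 : ℝ≥0∞) ^ (-(J : ℝ) + 1)) (ENNReal.ofReal (cc j)) ≤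
    2 ^ (1 - max ((j : ℝ) + 1) J) := by
  rw [ofReal_cc]
  rcases le_total ((j : ℝ) + 1) J with h | h
  · rw [max_eq_right h]
    refine (min_le_left _ _).trans (le_of_eq ?_)
    congr 1; ring
  · rw [max_eq_left h]
    refine (min_le_right _ _).trans ?_
    exact ENNReal.rpow_le_rpow_of_exponent_le (by norm_num) (by linarith)

theorem interp {x y z : ℝ≥0∞} (hx : z ≤ x) (hy : z ≤ y) {θ : ℝ} (h0 : 0 ≤ θ) (h1 : θ ≤ 1) :
    z ≤ x ^ (1 - θ) * y ^ θ := by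
  calc z = z ^ (1 - θ) * z ^ θ := by
        rw [← ENNReal.rpow_add_of_nonneg _ _ (by linarith) h0]; simp
    _ ≤ _ := by gcongr

theorem exp_bd1 {α β a q : ℝ} (hq : q = α + β) (haα : 2 * a ≤ α) (haβ : 2 * a ≤ β) (ha : 0 < a) (j J : ℝ) :
    α * j - (q - a) * max j J - a * J ≤ -(β * J) - a * |j - J| := by
  subst hq
  rcases le_total j J with h | h
  · rw [max_eq_right h, abs_of_nonpos (by linarith)]; nlinarith
  · rw [max_eq_left h, abs_of_nonneg (by linarith)]; nlinarith

theorem exp_bd2 {α β a q : ℝ} (hq : q = α + β) (haα : 2 * a ≤ α) (haβ : 2 * a ≤ β) (ha : 0 < a) (k K : ℝ) :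
    α * k - (q - a) * max k K - a * k ≤ -(β * K) - a * |k - K| := by
  subst hq
  rcases le_total k K with h | h
  · rw [max_eq_right h, abs_of_nonpos (by linarith)]; nlinarith
  · rw [max_eq_left h, abs_of_nonneg (by linarith)]; nlinarith

theorem main_bound (s r A : ℝ) (hs₁ : 3 / 2 < s) (hs₂ : s < 2) (hr : r < s / (s - 1))
    (hBH : BH s r A) :
    ∃ (a : ℝ) (C : ℝ≥0∞), 0 < a ∧ C ≠ ∞ ∧ ∀ (Ω W : Set (ℝ × ℝ)) (K J : ℕ) (δ : ℝ≥0∞),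
      MeasurableSet Ω → Ω ⊆ Icc 0 1 ×ˢ Icc 0 1 → MeasurableSet W → W ⊆ Ω →
      (∀ x : ℝ, (vFiber Ω x).Nonempty →
          (2 : ℝ≥0∞) ^ (-(K : ℝ) - 1) ≤ volume (vFiber Ω x) ∧
            volume (vFiber Ω x) ≤ (2 : ℝ≥0∞) ^ (-(K : ℝ) + 1)) →
        (2 : ℝ≥0∞) ^ (-(J : ℝ) - 1) ≤ volume (Prod.fst '' Ω) →
        volume (Prod.fst '' Ω) ≤ (2 : ℝ≥0∞) ^ (-(J : ℝ) + 1) →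
        (∀ y, volume (hFiber W y) ≤ δ * 2 ^ (-(J : ℝ))) →
        eLpNorm (extOp (chi W)) (ENNReal.ofReal (2 * s)) volume ≤
          C * δ ^ a * volume Ω ^ (1 - 1 / s) := by
  have hs0 : 0 < s := by linarith
  have hsm : 0 < s - 1 := by linarith
  obtain ⟨R, hRd⟩ : ∃ R, R = max r 1 := ⟨_, rfl⟩
  have hR1 : 1 ≤ R := by rw [hRd]; exact le_max_right _ _
  have hR0 : 0 < R := by linarith
  have hR : R < s / (s - 1) := by
    rw [hRd]; refine max_lt hr ?_
    rw [lt_div_iff₀ hsm]; linarith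
  have hR2 : R * (s - 1) < s := by rwa [lt_div_iff₀ hsm] at hR
  have hrs : R ≤ 2 * s := by
    refine hR.le.trans ?_
    rw [div_le_iff₀ hsm]; nlinarith
  obtain ⟨α, hα⟩ : ∃ α, α = 2 / R - 2 + 2 / s := ⟨_, rfl⟩
  obtain ⟨q, hq⟩ : ∃ q, q = 2 / R - 1 / s := ⟨_, rfl⟩
  obtain ⟨β, hβ⟩ : ∃ β, β = 2 - 3 / s := ⟨_, rfl⟩
  have hα0 : 0 < α := by
    have : α = 2 * (s - R * (s - 1)) / (R * s) := by rw [hα]; field_simp; ring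
    rw [this]; apply div_pos; linarith; positivity
  have hβ0 : 0 < β := by
    have : β = (2 * s - 3) / s := by rw [hβ]; field_simp
    rw [this]; apply div_pos; linarith; positivity
  have hqab : q = α + β := by rw [hq, hα, hβ]; ring
  have hq0 : 0 < q := by linarith
  obtain ⟨a, ha⟩ : ∃ a, a = min α β / 2 := ⟨_, rfl⟩
  have haα : 2 * a ≤ α := by rw [ha]; linarith [min_le_left α β]
  have haβ : 2 * a ≤ β := by rw [ha]; linarith [min_le_right α β]
  have ha0 : 0 < a := by rw [ha]; have := lt_min hα0 hβ0; linarith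
  obtain ⟨θ, hθ⟩ : ∃ θ, θ = a / q := ⟨_, rfl⟩
  have hθq : θ * q = a := by rw [hθ]; field_simp
  have hθ0 : 0 ≤ θ := by rw [hθ]; positivity
  have hθ1 : θ ≤ 1 := by rw [hθ, div_le_one hq0]; linarith
  obtain ⟨C, hC, hO⟩ := sum_bound s r A (by linarith) hs₂.le (by rw [← hRd]; exact hrs) hBH
  rw [← hRd] at hO
  obtain ⟨G, hG⟩ : ∃ G, G = ∑' n : ℤ, (2 : ℝ≥0∞) ^ (-(a * |(n : ℝ)|)) := ⟨_, rfl⟩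
  have hGt : G ≠ ∞ := by rw [hG]; exact geo_ne_top ha0
  refine ⟨a / 2, (C * ((2 : ℝ≥0∞) ^ (2 * (q - a)) * G * G * 2 ^ (2 * β))) ^ (1 / 2 : ℝ), by linarith, by
    finiteness, ?_⟩
  intro Ω W K J δ hΩ hΩ1 hW hWΩ hv hp1 hp2 hh
  have hc0 : ∀ j, 0 < cc j := fun j => by unfold cc; positivity
  have hμ : ∀ (j k : ℕ) m n, volume (W ∩ stile (cc j) (cc k) m n) ≤
      ((2 : ℝ≥0∞) ^ (1 - max ((j : ℝ) + 1) J) * 2 ^ (1 - max ((k : ℝ) + 1) K)) ^ (1 - θ) *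
      (δ * 2 ^ (-(J : ℝ)) * 2 ^ (-((k : ℝ) + 1))) ^ θ := by
    intro j k m n
    refine interp ?_ ?_ hθ0 hθ1
    · refine (tile_bound1 hW hWΩ (fun x hx => (hv x hx).2) hp2 (hc0 j) (hc0 k) m n).trans ?_
      exact mul_le_mul' (min_bd J j) (min_bd K k)
    · refine (tile_bound2 hW hh (hc0 k) m n).trans ?_
      rw [ofReal_cc]
  have hterm : ∀ j k : ℕ, ENNReal.ofReal (cc j * cc k) ^ (2 - 2 / s - 2 / R) *
      (((2 : ℝ≥0∞) ^ (1 - max ((j : ℝ) + 1) J) * 2 ^ (1 - max ((k : ℝ) + 1) K)) ^ (1 - θ) *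
      (δ * 2 ^ (-(J : ℝ)) * 2 ^ (-((k : ℝ) + 1))) ^ θ) ^ (2 / R - 1 / s) ≤
      (2 ^ (2 * (q - a)) * δ ^ a * 2 ^ (-(β * (J + K)))) *
        (2 ^ (-(a * |((j : ℝ) + 1) - J|)) * 2 ^ (-(a * |((k : ℝ) + 1) - K|))) := by
    intro j k
    have e1 := exp_bd1 hqab haα haβ ha0 ((j : ℝ) + 1) J
    have e2 := exp_bd2 hqab haα haβ ha0 ((k : ℝ) + 1) K
    have e0 : 2 - 2 / s - 2 / R = -α := by rw [hα]; ring
    rw [e0, ← hq, ENNReal.ofReal_mul (hc0 j).le, ofReal_cc, ofReal_cc, mul_assoc δ, ← two_add, ← two_add,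
      ← two_add, ENNReal.mul_rpow_of_nonneg _ _ hθ0, ENNReal.mul_rpow_of_nonneg _ _ hq0.le,
      ENNReal.mul_rpow_of_nonneg _ _ hq0.le]
    simp only [← ENNReal.rpow_mul]
    rw [hθq]
    have e3 : (1 - θ) * q = q - a := by rw [sub_mul, hθq, one_mul]
    rw [mul_assoc _ (1 - θ) q, e3, mul_assoc _ θ q, hθq]
    calc _ = δ ^ a * ((2 : ℝ≥0∞) ^ ((-((j : ℝ) + 1) + -((k : ℝ) + 1)) * -α) * 2 ^ ((1 - max ((j : ℝ) + 1) J + (1 - max ((k : ℝ) + 1) K)) * (q - a)) *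
          2 ^ ((-(J : ℝ) + -((k : ℝ) + 1)) * a)) := by ring
      _ ≤ δ ^ a * 2 ^ (2 * (q - a) + -(β * (J + K)) + (-(a * |((j : ℝ) + 1) - J|) + -(a * |((k : ℝ) + 1) - K|))) := by
          rw [← two_add, ← two_add]
          refine mul_le_mul' le_rfl (ENNReal.rpow_le_rpow_of_exponent_le (by norm_num) ?_)
          linarith
      _ = _ := by
          rw [two_add, two_add, two_add]; ring
  have hB := hO W hW (hWΩ.trans hΩ1) _ hμ ((2 ^ (2 * (q - a)) * δ ^ a * 2 ^ (-(β * (J + K)))) * (G * G)) (by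
    intro N
    refine (Finset.sum_le_sum fun j _ => Finset.sum_le_sum fun k _ => hterm j k).trans ?_
    simp_rw [← Finset.mul_sum]
    rw [← Finset.sum_mul, hG]
    gcongr
    · exact geo_sum_le J N
    · exact geo_sum_le K N)
  have hlow := vol_lower hΩ (fun x hx => (hv x hx).1) hp1
  rw [← two_add] at hlow
  have hlow2 : (2 : ℝ≥0∞) ^ (-(β * (J + K))) ≤ 2 ^ (2 * β) * volume Ω ^ β := by
    have h1 := ENNReal.rpow_le_rpow hlow hβ0.le
    rw [← ENNReal.rpow_mul] at h1
    calc (2 : ℝ≥0∞) ^ (-(β * (J + K))) = 2 ^ (2 * β) * 2 ^ ((-(K : ℝ) - 1 + (-(J : ℝ) - 1)) * β) := by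
          rw [← two_add]; congr 1; ring
      _ ≤ _ := by gcongr
  have hfin : eLpNorm (extOp (chi W)) (ENNReal.ofReal (2 * s)) volume ^ 2 ≤
      (C * ((2 : ℝ≥0∞) ^ (2 * (q - a)) * G * G * 2 ^ (2 * β))) * δ ^ a * volume Ω ^ (2 - 2 / s) := by
    have e4 : 2 - 2 / s = β + 1 / s := by rw [hβ]; ring
    rw [e4, ENNReal.rpow_add_of_nonneg _ _ hβ0.le (by positivity)]
    calc _ ≤ _ := hB
      _ ≤ C * ((2 ^ (2 * (q - a)) * δ ^ a * (2 ^ (2 * β) * volume Ω ^ β)) * (G * G) * volume Ω ^ (1 / s)) := by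
          gcongr
      _ = _ := by ring
  have hsq := ENNReal.rpow_le_rpow hfin (z := 1 / 2) (by norm_num)
  have e5 : ((2 : ℕ) : ℝ) * (1 / 2) = 1 := by norm_num
  rw [← ENNReal.rpow_natCast, ← ENNReal.rpow_mul, e5, ENNReal.rpow_one] at hsq
  refine hsq.trans (le_of_eq ?_)
  rw [ENNReal.mul_rpow_of_nonneg _ _ (by norm_num), ENNReal.mul_rpow_of_nonneg _ _ (by norm_num),
    ← ENNReal.rpow_mul, ← ENNReal.rpow_mul]
  have e6 : a * (1 / 2) = a / 2 := by ring
  have e7 : (2 - 2 / s) * (1 / 2) = 1 - 1 / s := by ring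
  rw [e6, e7]


/-- second-stage decomposition: under BH(s,r) with `3/2 < s < 2`, `r < s'`,
there are admissible constants `C₀, C'' > 0` such that, with `Ω, K, J, ε` as in the
near-extremizer setup, `C ≥ C₀`, `S_η` as in the first-stage decomposition,
`Ω¹_η = Ω ∩ π₁⁻¹(S_η)`, and `Ω²_{η,ρ} = π₂⁻¹(U_ρ) ∩ Ω¹_η`, for all dyadic `0 < ρ < η ≤ ε`
and every measurable `Ω' ⊆ Ω²_{η,ρ}`, `∥𝓔χ_{Ω'}∥_{L^{2s}} ≤ C''·ρ²·|Ω|^{1/s'}`. -/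
theorem stmt9 (s r A : ℝ) (hs₁ : 3 / 2 < s) (hs₂ : s < 2) (hr : r < s / (s - 1))
    (hBH : BH s r A) :
    ∃ C₀ C'' : ℝ, 0 < C₀ ∧ 0 < C'' ∧
      ∀ (Ω : Set (ℝ × ℝ)) (K J : ℕ) (ε C : ℝ), C₀ ≤ C →
        MeasurableSet Ω → Ω ⊆ Icc 0 1 ×ˢ Icc 0 1 →
        (∀ x : ℝ, (vFiber Ω x).Nonempty →
          (2 : ℝ≥0∞) ^ (-(K : ℤ) - 1) ≤ volume (vFiber Ω x) ∧
            volume (vFiber Ω x) ≤ (2 : ℝ≥0∞) ^ (-(K : ℤ) + 1)) →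
        (2 : ℝ≥0∞) ^ (-(J : ℤ) - 1) ≤ volume (Prod.fst '' Ω) →
        volume (Prod.fst '' Ω) ≤ (2 : ℝ≥0∞) ^ (-(J : ℤ) + 1) →
        IsDyadic ε → VargasBound s Ω ε →
        (∀ ε' : ℝ, IsDyadic ε' → ε' < ε → ¬ VargasBound s Ω ε') →
        ∀ η ρ : ℝ, IsDyadic η → IsDyadic ρ → 0 < ρ → ρ < η → η ≤ ε →
          ∀ Ω' ⊆ Prod.snd ⁻¹'
              (Uset (Ω ∩ Prod.fst ⁻¹' Sset (Prod.fst '' Ω) C J ε η) C J η ρ) ∩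
              (Ω ∩ Prod.fst ⁻¹' Sset (Prod.fst '' Ω) C J ε η),
            MeasurableSet Ω' →
            eLpNorm (extOp (chi Ω')) (ENNReal.ofReal (2 * s)) volume ≤
              ENNReal.ofReal (C'' * ρ ^ 2) * volume Ω ^ (1 - 1 / s) := by
  obtain ⟨a, C, ha, hC, hmain⟩ := main_bound s r A hs₁ hs₂ hr hBH
  have hz : ∀ n : ℤ, (2 : ℝ≥0∞) ^ n = (2 : ℝ≥0∞) ^ (n : ℝ) := fun n => (ENNReal.rpow_intCast _ _).symm
  refine ⟨2 / a, C.toReal * 2 ^ a * 4 + 1, by positivity, by positivity, ?_⟩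
  intro Ω K J ε C₁ hC₁ hΩ hΩ1 hv hp1 hp2 _ _ _ η ρ _ _ hρ hρη _ W hWs hW
  have hWΩ : W ⊆ Ω := fun ξ hξ => (hWs hξ).2.1
  simp only [hz] at hv hp1 hp2
  push_cast at hv hp1 hp2
  have key := fun δ hh => hmain Ω W K J δ hΩ hΩ1 hW hWΩ hv hp1 hp2 hh
  have hCr : C = ENNReal.ofReal C.toReal := (ENNReal.ofReal_toReal hC).symm
  have h2a : (1 : ℝ) ≤ 2 ^ a := Real.one_le_rpow (by norm_num) ha.le
  have hC0 : 0 ≤ C.toReal := ENNReal.toReal_nonneg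
  rcases le_or_gt (2 * ρ) 1 with h | h
  · have hk := key (ENNReal.ofReal ((2 * ρ) ^ C₁)) (by
      intro y
      by_cases hne : (hFiber W y).Nonempty
      · obtain ⟨x, hx⟩ := hne
        have hx' := hWs hx
        have hU := hx'.1
        rw [mem_preimage, Uset, if_pos hρη] at hU
        have hn := hU.2
        have hlt := not_le.mp fun hle => hn ⟨hU.1.1, hle⟩
        have hsub : hFiber W y ⊆ hFiber (Ω ∩ Prod.fst ⁻¹' Sset (Prod.fst '' Ω) C₁ J ε η) y :=
          fun z hz => (hWs hz).2
        refine (measure_mono hsub).trans (hlt.le.trans (le_of_eq ?_))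
        rw [ENNReal.ofReal_mul (by positivity)]
        congr 1
        rw [← Real.rpow_intCast, ← ENNReal.ofReal_rpow_of_pos (by norm_num)]
        push_cast
        simp
      · rw [not_nonempty_iff_eq_empty.mp hne]; simp)
    refine hk.trans ?_
    gcongr
    rw [ENNReal.ofReal_rpow_of_nonneg (by positivity) ha.le, hCr, ← ENNReal.ofReal_mul (by simp)]
    refine ENNReal.ofReal_le_ofReal ?_
    rw [← hCr]
    have h3 : ((2 * ρ) ^ C₁) ^ a ≤ 4 * ρ ^ 2 := by
      rw [← Real.rpow_mul (by positivity)]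
      have h4 : (2 : ℝ) ≤ C₁ * a := by rwa [div_le_iff₀ ha] at hC₁
      refine (Real.rpow_le_rpow_of_exponent_ge (by positivity) h h4).trans (le_of_eq ?_)
      rw [Real.rpow_two]; ring
    have h5 : 0 ≤ C.toReal * (4 * ρ ^ 2) := by positivity
    calc _ ≤ C.toReal * (4 * ρ ^ 2) := by gcongr
      _ ≤ C.toReal * (4 * ρ ^ 2) * 2 ^ a + ρ ^ 2 := by nlinarith [sq_nonneg ρ]
      _ = _ := by ring
  · have hk := key 2 (by
      intro y
      refine (measure_mono fun x hx => ?_).trans (hp2.trans (le_of_eq ?_))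
      · exact ⟨_, hWΩ hx, rfl⟩
      · rw [two_add, ENNReal.rpow_one, mul_comm])
    refine hk.trans ?_
    gcongr
    have : (2 : ℝ≥0∞) ^ a = ENNReal.ofReal (2 ^ a) := by
      rw [← ENNReal.ofReal_rpow_of_pos (by norm_num)]; simp
    rw [this, hCr, ← ENNReal.ofReal_mul (by simp)]
    refine ENNReal.ofReal_le_ofReal ?_
    rw [← hCr]
    have h5 : 0 ≤ C.toReal * 2 ^ a := by positivity
    have h6 : 1 ≤ 4 * ρ ^ 2 := by nlinarith
    calc C.toReal * 2 ^ a ≤ C.toReal * 2 ^ a * (4 * ρ ^ 2) := le_mul_of_one_le_right h5 h6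
      _ ≤ C.toReal * 2 ^ a * (4 * ρ ^ 2) + ρ ^ 2 := by nlinarith
      _ = _ := by ring
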